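/- arXiv:2107.08733 — 3 statements merged into one kernel-verified Lean document; each statement's English description precedes it below -/
import Mathlib

section
/- Let d ≥ 1 be an integer, let κ : (0,∞) × ℝ × ℝ → [0,1] be measurable and symmetric in its last two arguments, and let (W^{(i)})_{i ≥ 0} be i.i.d. real random variables. Suppose there exist t_0 > 0 and α > d such that E[κ(t, W^{(0)}, W^{(1)})] ≤ t^{-α} for all t > t_0. For x_0, …, x_j ∈ ℝ^d set 𝕎_j(x_0,…,x_j) := E[ ∏_{i=1}^{j} κ(‖x_i − x_{i-1}‖, W^{(i-1)}, W^{(i)}) ]. Then for every integer j ≥ 1 and every a > 1: lim_{m→∞} ∫_{(ℝ^d)^j} 𝕎_j(0, x_1, …, x_j) · 1{‖x_1‖ < a^m} · ∏_{i=1}^{j-2} 1{‖x_{i+1} − x_i‖ < a^{m^{i+1}}} · 1{‖x_j − x_{j-1}‖ > a^{m^j}} dx_1 ⋯ dx_j = 0, where empty products of indicators are taken equal to 1 and the integral is with respect to Lebesgue measure on (ℝ^d)^j. -/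
open MeasureTheory ProbabilityTheory Filter Topology
open scoped ENNReal NNReal

noncomputable section

/-- Euclidean space `ℝ^d`. -/
abbrev Euc (d : ℕ) : Type := EuclideanSpace ℝ (Fin d)

open Classical in
/-- Real-valued indicator of a proposition. -/
noncomputable def indic (p : Prop) : ℝ := if p then 1 else 0

/-- The box `I_n = [-n^{1/d}/2, n^{1/d}/2]^d`. -/
def boxIn (d n : ℕ) : Set (Euc d) :=
  {x | ∀ i, |x i| ≤ ((n : ℝ) ^ ((1 : ℝ) / d)) / 2}

/-- Uniform probability measure on the box `I_n` (which has Lebesgue measure `n`). -/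
noncomputable def unifBox (d n : ℕ) : Measure (Euc d) :=
  (n : ℝ≥0∞)⁻¹ • (volume.restrict (boxIn d n))

/-- Uniform probability measure on `[0,1]`. -/
noncomputable def unif01 : Measure ℝ := volume.restrict (Set.Icc 0 1)

/-- Uniform probability measure on the open Euclidean ball of radius `r` about the origin. -/
noncomputable def unifBall (d : ℕ) (r : ℝ) : Measure (Euc d) :=
  (volume (Metric.ball (0 : Euc d) r))⁻¹ • (volume.restrict (Metric.ball (0 : Euc d) r))

/-- The sequence of finite spatial inhomogeneous random graphs (SIRGs), on a probability
space `(Ω, P)`: for each `n`, vertex locations `Y n` are i.i.d. uniform on the box `I_n`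
(these are the blown-up locations `Y_i = n^{1/d} X_i` with `X_i` i.i.d. uniform on the unit
cube), `Wt n` is a random weight vector, `U n` is an array whose entries for `i < j` are
i.i.d. Uniform[0,1] variables, the three being mutually independent; `κn n` is a connection
function with values in `[0,1]` (for positive first argument), measurable and symmetric in
its last two arguments; `R n` is a pair of independent uniformly chosen vertices,
independent of everything else. -/
structure SIRGModel (d : ℕ) (Ω : Type) [MeasurableSpace Ω] where
  P : Measure Ω
  probP : IsProbabilityMeasure P
  Y : (n : ℕ) → Fin n → Ω → Euc d
  Wt : (n : ℕ) → Fin n → Ω → ℝ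
  U : (n : ℕ) → Fin n → Fin n → Ω → ℝ
  R : (n : ℕ) → 0 < n → Fin 2 → Ω → Fin n
  κn : ℕ → ℝ → ℝ → ℝ → ℝ
  Y_meas : ∀ n i, Measurable (Y n i)
  Wt_meas : ∀ n i, Measurable (Wt n i)
  U_meas : ∀ n i j, Measurable (U n i j)
  R_meas : ∀ n hn k, Measurable (R n hn k)
  κn_meas : ∀ n, Measurable (fun p : ℝ × ℝ × ℝ => κn n p.1 p.2.1 p.2.2)
  κn_nonneg : ∀ n t x y, 0 < t → 0 ≤ κn n t x y
  κn_le_one : ∀ n t x y, 0 < t → κn n t x y ≤ 1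
  κn_symm : ∀ n t x y, κn n t x y = κn n t y x
  joint_law : ∀ n : ℕ,
      Measure.map (fun ω =>
        ((fun i => Y n i ω), (fun i => Wt n i ω),
          (fun p : {p : Fin n × Fin n // p.1 < p.2} => U n p.1.1 p.1.2 ω))) P
        = (Measure.pi fun _ : Fin n => unifBox d n).prod
            ((Measure.map (fun ω i => Wt n i ω) P).prod
              (Measure.pi fun _ : {p : Fin n × Fin n // p.1 < p.2} => unif01))
  R_unif : ∀ n hn (i j : Fin n),
      P {ω | R n hn 0 ω = i ∧ R n hn 1 ω = j} = ((n : ℝ≥0∞) * n)⁻¹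
  R_indep : ∀ n hn,
      IndepFun (fun ω => (R n hn 0 ω, R n hn 1 ω))
        (fun ω => ((fun i => Y n i ω), (fun i => Wt n i ω), (fun i j => U n i j ω))) P

variable {d : ℕ} {Ω : Type} [MeasurableSpace Ω]

instance (M : SIRGModel d Ω) : IsProbabilityMeasure M.P := M.probP

/-- The random graph `𝔾_n`: for `i < j`, the edge `{i,j}` is present iff
`U_{ij} ≤ κ_n(‖Y_i - Y_j‖, W_i, W_j)`. -/
def SIRGModel.graph (M : SIRGModel d Ω) (n : ℕ) (ω : Ω) : SimpleGraph (Fin n) :=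
  SimpleGraph.fromRel (fun i j =>
    i < j ∧ M.U n i j ω ≤
      M.κn n (dist (M.Y n i ω) (M.Y n j ω)) (M.Wt n i ω) (M.Wt n j ω))

open Classical in
/-- Degree of a vertex in a finite simple graph. -/
noncomputable def degOf {V : Type*} [Fintype V] (G : SimpleGraph V) (v : V) : ℕ :=
  (Finset.univ.filter fun u => G.Adj v u).card

/-- Rooted isomorphism of rooted graphs. -/
def RootedIso {V₁ : Type*} {V₂ : Type*} (G₁ : SimpleGraph V₁) (r₁ : V₁)
    (G₂ : SimpleGraph V₂) (r₂ : V₂) : Prop :=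
  ∃ φ : G₁ ≃g G₂, φ r₁ = r₂

/-- The (vertex set of the) ball of radius `K` around `o` in the graph `G`:
all vertices reachable from `o` within graph distance `K`. -/
def graphBall {V : Type*} (G : SimpleGraph V) (o : V) (K : ℕ) : Set V :=
  {v | G.Reachable o v ∧ G.dist o v ≤ K}

/-- `ballIso G o K H h`: the subgraph of `G` induced by the `K`-ball around `o`, rooted at `o`,
is rooted-isomorphic to `(H, h)`. -/
def ballIso {V : Type*} (G : SimpleGraph V) (o : V) (K : ℕ)
    {V' : Type*} (H : SimpleGraph V') (h : V') : Prop :=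
  ∃ ho : o ∈ graphBall G o K, RootedIso (G.induce (graphBall G o K)) ⟨o, ho⟩ H h

/-- The set of vertices whose location lies within Euclidean distance `r` of the location
of vertex `i`. -/
def SIRGModel.euclSet (M : SIRGModel d Ω) (n : ℕ) (ω : Ω) (i : Fin n) (r : ℝ) :
    Set (Fin n) :=
  {j | dist (M.Y n j ω) (M.Y n i ω) < r}

/-- The Euclidean graph neighbourhood `F^{𝔾_n}_i(r)`: the subgraph of `𝔾_n` induced by the
vertices whose location is within distance `r` of the location of `i`. -/
def SIRGModel.euclNbhd (M : SIRGModel d Ω) (n : ℕ) (ω : Ω) (i : Fin n) (r : ℝ) :=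
  (M.graph n ω).induce (M.euclSet n ω i r)

/-- `F^{𝔾_n}_i(r)`, rooted at `i`, is rooted-isomorphic to `(H, h)`. -/
def SIRGModel.euclNbhdIso (M : SIRGModel d Ω) (n : ℕ) (ω : Ω) (i : Fin n) (r : ℝ)
    {V : Type*} (H : SimpleGraph V) (h : V) : Prop :=
  ∃ hi : i ∈ M.euclSet n ω i r, RootedIso (M.euclNbhd n ω i r) ⟨i, hi⟩ H h

/-- The set of vertices in the `K`-ball around `i` of the Euclidean neighbourhood graph
`F^{𝔾_n}_i(r)`, viewed as a subset of the vertex set of `𝔾_n`. -/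
def SIRGModel.spatialBall (M : SIRGModel d Ω) (n : ℕ) (ω : Ω) (i : Fin n) (r : ℝ)
    (K : ℕ) : Set (Fin n) :=
  {v | ∃ (hi : i ∈ M.euclSet n ω i r) (hv : v ∈ M.euclSet n ω i r),
      (⟨v, hv⟩ : M.euclSet n ω i r) ∈ graphBall (M.euclNbhd n ω i r) ⟨i, hi⟩ K}

/-- Empirical frequency of the rooted graph `(H,h)` among the Euclidean `r`-neighbourhoods
`F^{𝔾_n}_i(r)`, `i ∈ [n]`. -/
noncomputable def SIRGModel.empNbhdFreq (M : SIRGModel d Ω) (n : ℕ) (r : ℝ)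
    {V : Type*} (H : SimpleGraph V) (h : V) (ω : Ω) : ℝ :=
  (∑ i : Fin n, indic (M.euclNbhdIso n ω i r H h)) / n

/-- Empirical frequency of the rooted graph `(H,h)` among the rooted `K`-balls of `𝔾_n`. -/
noncomputable def SIRGModel.empBallFreq (M : SIRGModel d Ω) (n K : ℕ)
    {V : Type*} (H : SimpleGraph V) (h : V) (ω : Ω) : ℝ :=
  (∑ i : Fin n, indic (ballIso (M.graph n ω) i K H h)) / n

/-- Prepend the origin to a tuple of points. -/
def withZero {d l : ℕ} (z : Fin l → Euc d) : Fin (l + 1) → Euc d :=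
  Fin.cases 0 z

/-- The limiting graph on `l+1` vertices built from locations `0, z 0, …, z (l-1)`, weights `w`
and uniform variables `u`, with connection function `κ`. -/
def limitGraph (d : ℕ) (κ : ℝ → ℝ → ℝ → ℝ) (l : ℕ) (z : Fin l → Euc d)
    (w : Fin (l + 1) → ℝ) (u : Fin (l + 1) → Fin (l + 1) → ℝ) : SimpleGraph (Fin (l + 1)) :=
  SimpleGraph.fromRel (fun i j =>
    i < j ∧ u i j ≤ κ (dist (withZero z i) (withZero z j)) (w i) (w j))

/-- Poisson probability mass function with mean `lam`. -/
noncomputable def poissonWeight (lam : ℝ≥0∞) (k : ℕ) : ℝ≥0∞ :=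
  ENNReal.ofReal (Real.exp (-(lam.toReal)) * lam.toReal ^ k / (Nat.factorial k))

/-- The probability that the Poissonized limiting Euclidean `r`-neighbourhood `F_r`
(rooted at the vertex `0` located at the origin) is rooted-isomorphic to `(H,h)`:
the number `N` of non-root vertices is Poisson with mean `λ_d(B_r)`; given `N = l`, the
non-root locations are i.i.d. uniform on `B_r`, the `l+1` weights are i.i.d. with law `μW`,
and, given everything, edges are present independently with probabilities given by `κ`. -/
noncomputable def limitNbhdProb (d : ℕ) (κ : ℝ → ℝ → ℝ → ℝ) (μW : Measure ℝ) (r : ℝ)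
    {V : Type*} (H : SimpleGraph V) (h : V) : ℝ≥0∞ :=
  ∑' l : ℕ,
    poissonWeight (volume (Metric.ball (0 : Euc d) r)) l *
      ((Measure.pi fun _ : Fin l => unifBall d r).prod
          ((Measure.pi fun _ : Fin (l + 1) => μW).prod
            (Measure.pi fun _ : Fin (l + 1) => Measure.pi fun _ : Fin (l + 1) => unif01)))
        {zwu : (Fin l → Euc d) × (Fin (l + 1) → ℝ) × (Fin (l + 1) → Fin (l + 1) → ℝ) |
          RootedIso (limitGraph d κ l zwu.1 zwu.2.1 zwu.2.2) 0 H h}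

/-- The path expectation
`E[∏_{i=1}^{j} κ_n(‖x_i − x_{i-1}‖, W^{(n)}_{V_{i-1}}, W^{(n)}_{V_i})]`, where
`V_0, …, V_j` are i.i.d. uniform indices on `[n]`, independent of the weights `W^{(n)}`. -/
noncomputable def SIRGModel.pathExp (M : SIRGModel d Ω) (n j : ℕ)
    (x : Fin (j + 1) → Euc d) : ℝ :=
  ∫ ω, (∑ v : Fin (j + 1) → Fin n,
      ∏ i : Fin j,
        M.κn n (dist (x i.succ) (x i.castSucc)) (M.Wt n (v i.castSucc) ω)
          (M.Wt n (v i.succ) ω)) / (n : ℝ) ^ (j + 1) ∂M.P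

/-- `𝕎_j(x_0, …, x_j) = E[∏_{i=1}^{j} κ(‖x_i − x_{i-1}‖, W^{(i-1)}, W^{(i)})]` with
`W^{(0)}, …, W^{(j)}` i.i.d. with law `μW`. -/
noncomputable def Wfun (d : ℕ) (κ : ℝ → ℝ → ℝ → ℝ) (μW : Measure ℝ) (j : ℕ)
    (x : Fin (j + 1) → Euc d) : ℝ :=
  ∫ w : Fin (j + 1) → ℝ,
    ∏ i : Fin j, κ (dist (x i.succ) (x i.castSucc)) (w i.castSucc) (w i.succ)
    ∂(Measure.pi fun _ : Fin (j + 1) => μW)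

/-- The product of indicators
`∏_{i=1}^{j-1} 1{‖x_i − x_{i-1}‖ < a^{m^i}} · 1{‖x_j − x_{j-1}‖ > a^{m^j}}`. -/
noncomputable def pathIndic {d : ℕ} (j : ℕ) (a m : ℝ) (x : Fin (j + 1) → Euc d) : ℝ≥0∞ :=
  ∏ i : Fin j,
    if i.val + 1 < j then
      (if dist (x i.succ) (x i.castSucc) < a ^ (m ^ (i.val + 1)) then 1 else 0)
    else
      (if a ^ (m ^ j) < dist (x i.succ) (x i.castSucc) then 1 else 0)

/-- The indicator of `z_k ∈ B(a^{m^k})` for `1 ≤ k ≤ j-1` and `z_j ∉ B(a^{m^j})`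
(with `z` indexed by `Fin j`, so `z i` stands for `z_{i+1}`). -/
noncomputable def shellIndic {d : ℕ} (j : ℕ) (a m : ℝ) (z : Fin j → Euc d) : ℝ≥0∞ :=
  ∏ i : Fin j,
    if i.val + 1 < j then
      (if ‖z i‖ < a ^ (m ^ (i.val + 1)) then 1 else 0)
    else
      (if a ^ (m ^ j) ≤ ‖z i‖ then 1 else 0)

/-- The expectation `E[κ_n(t, W^{(n)}_{V_1}, W^{(n)}_{V_2})]`, where `V_1, V_2` are i.i.d.
uniform indices on `[n]`, independent of the weights. -/
noncomputable def SIRGModel.expKn (M : SIRGModel d Ω) (n : ℕ) (t : ℝ) : ℝ :=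
  ∫ ω, (∑ v : Fin n × Fin n, M.κn n t (M.Wt n v.1 ω) (M.Wt n v.2 ω)) / (n : ℝ) ^ 2 ∂M.P

/-- The radius `r(a, m, K) = a^m + a^{m^2} + ⋯ + a^{m^K}`. -/
noncomputable def rr (a m : ℝ) (K : ℕ) : ℝ :=
  ∑ k ∈ Finset.range K, a ^ (m ^ (k + 1))

/-- Assumptions (A1)–(A2): convergence in probability of the empirical weight distribution
to the law `μW` of the limiting weight (at every continuity point of its cdf), and
convergence of the connection functions `κn` to a limiting connection function `κ`. -/
structure SIRGWeakAssumptions {d : ℕ} {Ω : Type} [MeasurableSpace Ω] (M : SIRGModel d Ω) where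
  μW : Measure ℝ
  probμW : IsProbabilityMeasure μW
  weights_conv : ∀ x : ℝ, μW {x} = 0 →
    TendstoInMeasure M.P
      (fun n ω => (∑ i : Fin n, indic (M.Wt n i ω ≤ x)) / n) atTop
      (fun _ => (μW (Set.Iic x)).toReal)
  κ : ℝ → ℝ → ℝ → ℝ
  κ_meas : Measurable fun p : ℝ × ℝ × ℝ => κ p.1 p.2.1 p.2.2
  κ_nonneg : ∀ t x y, 0 < t → 0 ≤ κ t x y
  κ_le_one : ∀ t x y, 0 < t → κ t x y ≤ 1
  κ_symm : ∀ t x y, κ t x y = κ t y x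
  κ_conv : ∀ (x y : ℝ) (xs ys : ℕ → ℝ),
      Tendsto xs atTop (𝓝 x) → Tendsto ys atTop (𝓝 y) →
      ∀ᵐ t ∂(volume : Measure ℝ), 0 < t →
        Tendsto (fun n => M.κn n t (xs n) (ys n)) atTop (𝓝 (κ t x y))

/-- Assumptions (A1)–(A3): additionally, the polynomial tail bound
`E[κ(t, W^{(1)}, W^{(2)})] ≤ t^{-α}` with `α > d`, for all `t > t₀`. -/
structure SIRGAssumptions {d : ℕ} {Ω : Type} [MeasurableSpace Ω] (M : SIRGModel d Ω)
    extends SIRGWeakAssumptions M where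
  t₀ : ℝ
  α : ℝ
  t₀_pos : 0 < t₀
  α_gt_dim : (d : ℝ) < α
  κ_tail : ∀ t : ℝ, t₀ < t →
      ∫ p : ℝ × ℝ, κ t p.1 p.2 ∂(μW.prod μW) ≤ t ^ (-α)


/-- Iterated integral of a product of functions of increments. -/
theorem lint_increments {d : ℕ} : ∀ (j : ℕ) (f : Fin j → Euc d → ℝ≥0∞) (_ : ∀ i, Measurable (f i))
    (x0 : Euc d),
    ∫⁻ y : Fin j → Euc d, ∏ i : Fin j,
      f i ((Fin.cons x0 y : Fin (j + 1) → Euc d) i.succ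
        - (Fin.cons x0 y : Fin (j + 1) → Euc d) i.castSucc)
      ∂(Measure.pi fun _ : Fin j => (volume : Measure (Euc d)))
      = ∏ i : Fin j, ∫⁻ z, f i z := by
  intro j
  induction j with
  | zero => intro f hf x0; simp
  | succ n ih =>
    intro f hf x0
    have hmp := (measurePreserving_piFinSuccAbove
      (fun _ : Fin (n + 1) => (volume : Measure (Euc d))) 0).symm
    rw [← hmp.lintegral_comp_emb (MeasurableEquiv.measurableEmbedding _)]
    have hmeas : Measurable (fun p : Euc d × (Fin n → Euc d) =>
        f 0 (p.1 - x0) * ∏ i : Fin n,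
          f i.succ ((Fin.cons p.1 p.2 : Fin (n + 1) → Euc d) i.succ
            - (Fin.cons p.1 p.2 : Fin (n + 1) → Euc d) i.castSucc)) := by
      refine Measurable.mul ((hf 0).comp (by fun_prop)) ?_
      refine Finset.measurable_prod _ fun i _ => (hf _).comp ?_
      have hc : Measurable (fun p : Euc d × (Fin n → Euc d) =>
          (Fin.cons p.1 p.2 : Fin (n + 1) → Euc d)) := by
        refine measurable_pi_iff.2 fun k => ?_
        refine Fin.cases ?_ (fun k => ?_) k
        · simpa using measurable_fst
        · exact (measurable_pi_apply k).comp measurable_snd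
      exact ((measurable_pi_apply _).comp hc).sub ((measurable_pi_apply _).comp hc)
    have heq : ∀ p : Euc d × (Fin n → Euc d),
        (∏ i : Fin (n + 1),
          f i ((Fin.cons x0 ((MeasurableEquiv.piFinSuccAbove (fun _ => Euc d) 0).symm p) :
              Fin (n + 2) → Euc d) i.succ
            - (Fin.cons x0 ((MeasurableEquiv.piFinSuccAbove (fun _ => Euc d) 0).symm p) :
              Fin (n + 2) → Euc d) i.castSucc))
        = f 0 (p.1 - x0) * ∏ i : Fin n,
          f i.succ ((Fin.cons p.1 p.2 : Fin (n + 1) → Euc d) i.succ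
            - (Fin.cons p.1 p.2 : Fin (n + 1) → Euc d) i.castSucc) := by
      intro p
      have h : (MeasurableEquiv.piFinSuccAbove (fun _ : Fin (n + 1) => Euc d) 0).symm p
          = (Fin.cons p.1 p.2 : Fin (n + 1) → Euc d) := by
        ext k
        simp [MeasurableEquiv.piFinSuccAbove, Fin.insertNthEquiv]
      rw [h, Fin.prod_univ_succ]
      congr 1
    simp_rw [heq]
    rw [lintegral_prod _ hmeas.aemeasurable]
    have hcm : ∀ x : Euc d, Measurable (fun y : Fin n → Euc d => ∏ i : Fin n,
          f i.succ ((Fin.cons x y : Fin (n + 1) → Euc d) i.succ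
            - (Fin.cons x y : Fin (n + 1) → Euc d) i.castSucc)) := by
      intro x
      refine Finset.measurable_prod _ fun i _ => (hf _).comp ?_
      have hc : Measurable (fun y : Fin n → Euc d => (Fin.cons x y : Fin (n + 1) → Euc d)) := by
        refine measurable_pi_iff.2 fun k => ?_
        refine Fin.cases ?_ (fun k => ?_) k
        · simp
        · simpa using measurable_pi_apply k
      exact ((measurable_pi_apply _).comp hc).sub ((measurable_pi_apply _).comp hc)
    have : ∀ x : Euc d, ∫⁻ y : Fin n → Euc d, f 0 (x - x0) * ∏ i : Fin n,
          f i.succ ((Fin.cons x y : Fin (n + 1) → Euc d) i.succ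
            - (Fin.cons x y : Fin (n + 1) → Euc d) i.castSucc)
          ∂(Measure.pi fun _ : Fin n => (volume : Measure (Euc d)))
        = f 0 (x - x0) * ∏ i : Fin n, ∫⁻ z, f i.succ z := by
      intro x
      rw [lintegral_const_mul _ (hcm x), ih (fun i => f i.succ) (fun i => hf _) x]
    have h2 := fun x : Euc d => this x
    simp only [] at h2 ⊢
    have hf0 : Measurable (fun x : Euc d => f 0 (x - x0)) := (hf 0).comp (by fun_prop)
    rw [lintegral_congr h2, lintegral_mul_const _ hf0,
      lintegral_sub_right_eq_self (fun x => f 0 x) x0, Fin.prod_univ_succ]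

theorem withZero_eq_cons {d l : ℕ} (z : Fin l → Euc d) :
    withZero z = (Fin.cons 0 z : Fin (l + 1) → Euc d) := rfl

theorem ae_incr_pos {d : ℕ} (hd : 1 ≤ d) (j : ℕ) :
    ∀ᵐ y ∂(Measure.pi fun _ : Fin j => (volume : Measure (Euc d))),
      ∀ i : Fin j, 0 < dist (withZero y i.succ) (withZero y i.castSucc) := by
  rw [ae_all_iff]
  intro i
  have : Nonempty (Fin d) := ⟨⟨0, hd⟩⟩
  have h := lint_increments j (fun k : Fin j => if k = i then Set.indicator {(0 : Euc d)} 1 else 1)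
    (by
      intro k
      split_ifs
      · exact measurable_one.indicator (measurableSet_singleton _)
      · exact measurable_one) 0
  have h0 : ∏ k : Fin j, ∫⁻ z, (if k = i then Set.indicator {(0 : Euc d)} (1 : Euc d → ℝ≥0∞) else 1) z = 0 := by
    refine Finset.prod_eq_zero (Finset.mem_univ i) ?_
    rw [if_pos rfl, lintegral_indicator_one (measurableSet_singleton (0 : Euc d)), measure_singleton]
  rw [h0] at h
  have hm : Measurable (fun y : Fin j → Euc d => ∏ k : Fin j,
      (if k = i then Set.indicator {(0 : Euc d)} (1 : Euc d → ℝ≥0∞) else 1)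
      ((Fin.cons 0 y : Fin (j + 1) → Euc d) k.succ
        - (Fin.cons 0 y : Fin (j + 1) → Euc d) k.castSucc)) := by
    have hc : Measurable (fun y : (Fin j → Euc d) =>
          (Fin.cons 0 y : Fin (j + 1) → Euc d)) := by
      refine measurable_pi_iff.2 fun k => ?_
      refine Fin.cases ?_ (fun k => ?_) k
      · simp
      · simpa using (measurable_pi_apply k)
    have hg : ∀ k : Fin j, Measurable
        (if k = i then Set.indicator {(0 : Euc d)} (1 : Euc d → ℝ≥0∞) else 1) := by
      intro k
      split_ifs
      · exact measurable_one.indicator (measurableSet_singleton _)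
      · exact measurable_one
    exact Finset.measurable_prod _ fun k _ => (hg k).comp
      (((measurable_pi_apply _).comp hc).sub ((measurable_pi_apply _).comp hc))
  rw [lintegral_eq_zero_iff hm] at h
  filter_upwards [h] with y hy
  rw [dist_pos]
  intro hne
  have : (1 : ℝ≥0∞) = 0 := by
    refine Eq.trans (Eq.symm ?_) hy
    refine Finset.prod_eq_one fun k _ => ?_
    split_ifs with hk
    · subst hk
      rw [withZero_eq_cons] at hne
      simp only [hne, sub_self]
      simp
    · rfl
  exact one_ne_zero this

theorem map_pair {n : ℕ} (μW : Measure ℝ) [IsProbabilityMeasure μW] (i k : Fin n) (h : i ≠ k) :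
    Measure.map (fun w : Fin n → ℝ => (w i, w k)) (Measure.pi fun _ => μW) = μW.prod μW := by
  have hi : iIndepFun (fun (i : Fin n) (w : Fin n → ℝ) => w i) (Measure.pi fun _ => μW) :=
    iIndepFun_pi (X := fun _ x => x) (fun _ => aemeasurable_id)
  have h2 := (indepFun_iff_map_prod_eq_prod_map_map (measurable_pi_apply i).aemeasurable
    (measurable_pi_apply k).aemeasurable).1 (hi.indepFun h)
  rw [h2]
  congr 1
  · exact (measurePreserving_eval (fun _ : Fin n => μW) i).map_eq
  · exact (measurePreserving_eval (fun _ : Fin n => μW) k).map_eq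

theorem Wfun_le {d : ℕ} {κ : ℝ → ℝ → ℝ → ℝ}
    (hκ_meas : Measurable fun p : ℝ × ℝ × ℝ => κ p.1 p.2.1 p.2.2)
    (hκ_nonneg : ∀ t x y, 0 < t → 0 ≤ κ t x y)
    (hκ_le_one : ∀ t x y, 0 < t → κ t x y ≤ 1)
    (μW : Measure ℝ) [IsProbabilityMeasure μW] (n : ℕ) (x : Fin (n + 2) → Euc d)
    (hx : ∀ i : Fin (n + 1), 0 < dist (x i.succ) (x i.castSucc)) :
    Wfun d κ μW (n + 1) x ≤ ∫ p : ℝ × ℝ,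
      κ (dist (x (Fin.last n).succ) (x (Fin.last n).castSucc)) p.1 p.2 ∂(μW.prod μW) := by
  have hm : Measurable (fun p : ℝ × ℝ =>
      κ (dist (x (Fin.last n).succ) (x (Fin.last n).castSucc)) p.1 p.2) :=
    hκ_meas.comp (measurable_const.prodMk measurable_id)
  have hne : (Fin.last n).castSucc ≠ (Fin.last n).succ := by
    intro h; have := congrArg Fin.val h; simp at this
  rw [← map_pair μW _ _ hne, integral_map (by fun_prop) hm.aestronglyMeasurable]
  refine integral_mono_of_nonneg (ae_of_all _ fun w => ?_) ?_ (ae_of_all _ fun w => ?_)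
  · exact Finset.prod_nonneg fun i _ => hκ_nonneg _ _ _ (hx i)
  · refine Integrable.of_bound (C := 1) (hm.comp (by fun_prop : Measurable
      fun w : Fin (n + 2) → ℝ => (w (Fin.last n).castSucc, w (Fin.last n).succ))).aestronglyMeasurable
      (ae_of_all _ fun w => ?_)
    rw [Real.norm_eq_abs, abs_le]
    exact ⟨by linarith [hκ_nonneg _ (w (Fin.last n).castSucc) (w (Fin.last n).succ) (hx (Fin.last n))],
      hκ_le_one _ _ _ (hx _)⟩
  · show ∏ i : Fin (n + 1), _ ≤ _
    rw [Fin.prod_univ_castSucc]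
    refine mul_le_of_le_one_left (hκ_nonneg _ _ _ (hx _)) ?_
    exact Finset.prod_le_one (fun i _ => hκ_nonneg _ _ _ (hx _)) fun i _ => hκ_le_one _ _ _ (hx _)

/-- Tail integral bound. -/
theorem tail_bound (d : ℕ) (α : ℝ) (hα : (d : ℝ) < α) :
    ∃ C : ℝ≥0∞, C ≠ ⊤ ∧ ∀ R : ℝ, 1 ≤ R →
      ∫⁻ z : Euc d, Set.indicator {z : Euc d | R < ‖z‖} (fun z => ENNReal.ofReal (‖z‖ ^ (-α))) z
        ≤ ENNReal.ofReal (R ^ (-((α - d) / 2))) * C := by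
  have hint : Integrable (fun z : Euc d => (2 : ℝ) ^ ((α + d) / 2) * (1 + ‖z‖) ^ (-((α + d) / 2))) :=
    (integrable_one_add_norm (by simp; linarith)).const_mul _
  refine ⟨∫⁻ z : Euc d, ENNReal.ofReal
    ((2 : ℝ) ^ ((α + d) / 2) * (1 + ‖z‖) ^ (-((α + d) / 2))), ?_, ?_⟩
  · exact (hint.lintegral_lt_top).ne
  · intro R hR
    rw [← lintegral_const_mul' _ _ ENNReal.ofReal_ne_top]
    refine lintegral_mono fun z => ?_
    by_cases hz : z ∈ {z : Euc d | R < ‖z‖}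
    swap
    · rw [Set.indicator_of_notMem hz]; exact bot_le
    rw [Set.indicator_of_mem hz]
    rw [← ENNReal.ofReal_mul (by positivity)]
    refine ENNReal.ofReal_le_ofReal ?_
    have hz : R < ‖z‖ := hz
    have hz0 : 0 < ‖z‖ := by linarith
    have e1 : ‖z‖ ^ (-α) = ‖z‖ ^ (-((α - d) / 2)) * ‖z‖ ^ (-((α + d) / 2)) := by
      rw [← Real.rpow_add hz0]; congr 1; ring
    have hd0 : (0 : ℝ) ≤ d := Nat.cast_nonneg d
    rw [e1]
    refine mul_le_mul ?_ ?_ (by positivity) (by positivity)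
    · exact Real.rpow_le_rpow_of_nonpos (by linarith) hz.le (by linarith)
    · have : (2 : ℝ) ^ ((α + d) / 2) * (1 + ‖z‖) ^ (-((α + d) / 2))
          = ((1 + ‖z‖) / 2) ^ (-((α + d) / 2)) := by
        rw [Real.div_rpow (by positivity) (by positivity), Real.rpow_neg (by norm_num : (0:ℝ) ≤ 2)]
        field_simp
      rw [this]
      exact Real.rpow_le_rpow_of_nonpos (by positivity) (by linarith) (by linarith)

/-- Lemma: path counting estimate, limiting version.
Let `κ : (0,∞) × ℝ × ℝ → [0,1]` be measurable and symmetric, let the weights be i.i.d. with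
law `μW`, and assume the tail bound `E[κ(t, W⁰, W¹)] ≤ t^{-α}` for `t > t₀`, with `α > d`.
Then for every `j ≥ 1` and `a > 1`, the integral over `(ℝ^d)^j` of
`𝕎_j(0, x_1, …, x_j)` times the indicators
`1{‖x_1‖ < a^m} ∏_{i=1}^{j-2} 1{‖x_{i+1} − x_i‖ < a^{m^{i+1}}} · 1{‖x_j − x_{j-1}‖ > a^{m^j}}`
tends to `0` as `m → ∞`. -/
theorem stmt4 (d : ℕ) (hd : 1 ≤ d) (κ : ℝ → ℝ → ℝ → ℝ)
    (hκ_meas : Measurable fun p : ℝ × ℝ × ℝ => κ p.1 p.2.1 p.2.2)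
    (hκ_nonneg : ∀ t x y, 0 < t → 0 ≤ κ t x y)
    (hκ_le_one : ∀ t x y, 0 < t → κ t x y ≤ 1)
    (hκ_symm : ∀ t x y, κ t x y = κ t y x)
    (μW : Measure ℝ) (hμW : IsProbabilityMeasure μW)
    (t₀ α : ℝ) (ht₀ : 0 < t₀) (hα : (d : ℝ) < α)
    (htail : ∀ t : ℝ, t₀ < t → ∫ p : ℝ × ℝ, κ t p.1 p.2 ∂(μW.prod μW) ≤ t ^ (-α))
    (j : ℕ) (hj : 1 ≤ j) (a : ℝ) (ha : 1 < a) :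
    Tendsto (fun m : ℝ =>
        ∫⁻ y : Fin j → Euc d,
          ENNReal.ofReal (Wfun d κ μW j (withZero y)) * pathIndic j a m (withZero y)
          ∂(Measure.pi fun _ : Fin j => (volume : Measure (Euc d))))
      atTop (𝓝 0) := by
  obtain ⟨n, rfl⟩ : ∃ n, j = n + 1 := ⟨j - 1, by omega⟩
  obtain ⟨C, hC, htb⟩ := tail_bound d α hα
  set δ : ℝ := (α - d) / 2 with hδ
  have hδ0 : 0 < δ := by rw [hδ]; linarith
  set V : ℝ≥0∞ := volume (Metric.ball (0 : Euc d) 1) with hV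
  have hVt : V ≠ ⊤ := measure_ball_lt_top.ne
  have ha0 : 0 < a := by linarith
  -- the main bound
  have hbound : ∀ᶠ m : ℝ in atTop,
      ∫⁻ y : Fin (n + 1) → Euc d,
          ENNReal.ofReal (Wfun d κ μW (n + 1) (withZero y)) * pathIndic (n + 1) a m (withZero y)
          ∂(Measure.pi fun _ : Fin (n + 1) => (volume : Measure (Euc d)))
      ≤ ENNReal.ofReal (a ^ ((n * d : ℝ) - δ * m)) * (V ^ n * C) := by
    have hlarge : ∀ᶠ m : ℝ in atTop, t₀ ≤ a ^ m :=
      (tendsto_rpow_atTop_of_base_gt_one a ha).eventually_ge_atTop t₀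
    filter_upwards [hlarge, eventually_ge_atTop (1 : ℝ), eventually_ge_atTop ((n * d : ℝ) / δ)]
      with m hm hm1 hm2
    have hpm : m ≤ m ^ (n + 1) := le_self_pow₀ hm1 (by omega)
    have hR : a ^ m ≤ a ^ (m ^ (n + 1)) := Real.rpow_le_rpow_of_exponent_le ha.le hpm
    have hR1 : 1 ≤ a ^ (m ^ (n + 1)) := Real.one_le_rpow ha.le (by positivity)
    let f : Fin (n + 1) → Euc d → ℝ≥0∞ := fun i =>
      if i.val + 1 < n + 1 then Set.indicator (Metric.ball (0 : Euc d) (a ^ (m ^ (i.val + 1)))) 1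
      else Set.indicator {z : Euc d | a ^ (m ^ (n + 1)) < ‖z‖}
        (fun z => ENNReal.ofReal (‖z‖ ^ (-α)))
    have hf : ∀ i, Measurable (f i) := by
      intro i
      simp only [f]
      split_ifs
      · exact measurable_one.indicator measurableSet_ball
      · exact Measurable.indicator (by fun_prop) (measurableSet_lt measurable_const measurable_norm)
    have h1 : ∫⁻ y : Fin (n + 1) → Euc d,
          ENNReal.ofReal (Wfun d κ μW (n + 1) (withZero y)) * pathIndic (n + 1) a m (withZero y)
          ∂(Measure.pi fun _ : Fin (n + 1) => (volume : Measure (Euc d)))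
        ≤ ∏ i : Fin (n + 1), ∫⁻ z, f i z := by
      rw [← lint_increments (n + 1) f hf 0]
      refine lintegral_mono_ae ?_
      filter_upwards [ae_incr_pos hd (n + 1)] with y hy
      rw [← withZero_eq_cons]
      have hW := Wfun_le hκ_meas hκ_nonneg hκ_le_one μW n (withZero y) hy
      rw [pathIndic, Fin.prod_univ_castSucc, Fin.prod_univ_castSucc]
      have hprod : ∀ i : Fin n, f i.castSucc (withZero y i.castSucc.succ - withZero y i.castSucc.castSucc)
          = if i.castSucc.val + 1 < n + 1 then
            (if dist (withZero y i.castSucc.succ) (withZero y i.castSucc.castSucc)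
              < a ^ (m ^ (i.castSucc.val + 1)) then 1 else 0)
            else
            (if a ^ (m ^ (n + 1)) < dist (withZero y i.castSucc.succ) (withZero y i.castSucc.castSucc)
              then 1 else 0) := by
        intro i
        have hi : i.castSucc.val + 1 < n + 1 := by simp
        simp only [f, if_pos hi, dist_eq_norm]
        split_ifs with hlt
        · rw [Set.indicator_of_mem (mem_ball_zero_iff.2 hlt), Pi.one_apply]
        · rw [Set.indicator_of_notMem (fun h => hlt (mem_ball_zero_iff.1 h))]
      rw [Finset.prod_congr rfl fun i _ => hprod i]
      have hl : ¬ ((Fin.last n).val + 1 < n + 1) := by simp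
      rw [if_neg hl]
      simp only [f, if_neg hl, Set.indicator_apply, Set.mem_ofPred_eq, ← dist_eq_norm]
      rw [mul_left_comm]
      gcongr
      split_ifs with hd1
      · rw [mul_one]
        exact ENNReal.ofReal_le_ofReal (hW.trans (htail _ (by linarith)))
      · simp
    refine h1.trans ?_
    rw [Fin.prod_univ_castSucc]
    have hball : ∀ i : Fin n, ∫⁻ z, f i.castSucc z ≤ ENNReal.ofReal (a ^ (m ^ n * d)) * V := by
      intro i
      have hi : i.castSucc.val + 1 < n + 1 := by simp
      simp only [f, if_pos hi]
      rw [lintegral_indicator_one measurableSet_ball, Measure.addHaar_ball_of_pos _ _ (by positivity)]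
      gcongr
      rw [finrank_euclideanSpace_fin, ← Real.rpow_natCast, ← Real.rpow_mul ha0.le]
      refine Real.rpow_le_rpow_of_exponent_le ha.le ?_
      have hin : i.castSucc.val + 1 ≤ n := i.isLt
      exact mul_le_mul_of_nonneg_right (pow_le_pow_right₀ hm1 hin) (Nat.cast_nonneg d)
    have hlast : ∫⁻ z, f (Fin.last n) z ≤ ENNReal.ofReal (a ^ (m ^ (n + 1) * (-δ))) * C := by
      have hl : ¬ ((Fin.last n).val + 1 < n + 1) := by simp
      simp only [f, if_neg hl]
      refine (htb _ hR1).trans ?_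
      rw [← Real.rpow_mul ha0.le]
    calc _ ≤ (∏ i : Fin n, ENNReal.ofReal (a ^ (m ^ n * d)) * V)
          * (ENNReal.ofReal (a ^ (m ^ (n + 1) * (-δ))) * C) :=
          mul_le_mul' (Finset.prod_le_prod' fun i _ => hball i) hlast
      _ = ENNReal.ofReal ((a ^ (m ^ n * d)) ^ n * a ^ (m ^ (n + 1) * (-δ))) * (V ^ n * C) := by
          rw [ENNReal.ofReal_mul (by positivity), ENNReal.ofReal_pow (by positivity)]
          simp only [Finset.prod_const, Finset.card_univ, Fintype.card_fin]
          ring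
      _ ≤ _ := by
          gcongr
          rw [← Real.rpow_natCast, ← Real.rpow_mul ha0.le, ← Real.rpow_add ha0]
          refine Real.rpow_le_rpow_of_exponent_le ha.le ?_
          have h1 : 1 ≤ m ^ n := one_le_pow₀ hm1
          have h2 : (n * d : ℝ) ≤ m * δ := (div_le_iff₀ hδ0).1 hm2
          rw [pow_succ]
          nlinarith [mul_nonneg (sub_nonneg.2 h1) (sub_nonneg.2 h2)]
  have hlim : Tendsto (fun m : ℝ => ENNReal.ofReal (a ^ ((n * d : ℝ) - δ * m)) * (V ^ n * C))
      atTop (𝓝 0) := by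
    have h1 : Tendsto (fun m : ℝ => a ^ ((n * d : ℝ) - δ * m)) atTop (𝓝 0) := by
      refine (tendsto_rpow_atBot_of_base_gt_one a ha).comp ?_
      refine tendsto_atBot_add_const_left _ (n * d : ℝ) (tendsto_neg_atTop_atBot.comp
        (tendsto_id.const_mul_atTop hδ0))
    have h2 := ENNReal.Tendsto.mul_const (b := V ^ n * C) (ENNReal.tendsto_ofReal h1)
      (Or.inr (ENNReal.mul_ne_top (ENNReal.pow_ne_top hVt) hC))
    simpa using h2
  exact tendsto_of_tendsto_of_tendsto_of_le_of_le' tendsto_const_nhds hlim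
    (Eventually.of_forall fun _ => zero_le) hbound

end
end

section
/- In the SIRG model (no further assumptions needed), for any m > 1, any reals a_n > 1 and integers K_n ≥ 1, set r_n := a_n^m + a_n^{m^2} + ⋯ + a_n^{m^{K_n}}. Then for every n: P( the set of vertices at graph distance at most K_n from U_n in 𝔾_n differs from the set of vertices at graph distance at most K_n from U_n in F^{𝔾_n}_{U_n}(r_n) ) ≤ Σ_{j=1}^{K_n} ∫_{B(a_n^m)} ⋯ ∫_{B(a_n^{m^{j-1}})} ∫_{ℝ^d ∖ B(a_n^{m^j})} E[ κ_n(‖z_j‖, W^{(n)}_{V_1}, W^{(n)}_{V_2}) ] dz_j dz_{j-1} ⋯ dz_1, where B(s) denotes the open Euclidean ball of radius s about the origin in ℝ^d and V_1, V_2 are i.i.d. uniform random indices on {1,…,n} independent of W^{(n)}. -/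
open MeasureTheory ProbabilityTheory Filter Topology
open scoped ENNReal NNReal

noncomputable section

variable {d : ℕ} {Ω : Type} [MeasurableSpace Ω]

lemma spatial_eq_of_no_jump {d : ℕ} {Ω : Type} [MeasurableSpace Ω] (M : SIRGModel d Ω)
    (n : ℕ) (ω : Ω) (o : Fin n) (a m : ℝ) (ha : 1 < a) (K : ℕ) (hK : 1 ≤ K)
    (H : ¬ ∃ j < K, ∃ v : Fin (j + 2) → Fin n, Function.Injective v ∧ v 0 = o ∧
      (∀ i : Fin (j + 1), if i.val + 1 < j + 1 then
        dist (M.Y n (v i.castSucc) ω) (M.Y n (v i.succ) ω) < a ^ (m ^ (i.val + 1))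
        else a ^ (m ^ (j + 1)) ≤ dist (M.Y n (v i.castSucc) ω) (M.Y n (v i.succ) ω)) ∧
      (M.graph n ω).Adj (v (Fin.last j).castSucc) (v (Fin.last j).succ)) :
    M.spatialBall n ω o (rr a m K) K = graphBall (M.graph n ω) o K := by
  have hb : ∀ k : ℕ, 0 < a ^ (m ^ (k + 1)) := fun k => Real.rpow_pos_of_pos (by linarith) _
  have hmono : ∀ i, i < K → rr a m i < rr a m K := by
    intro i hi
    unfold rr
    exact Finset.sum_lt_sum_of_subset (i := i)
      (Finset.range_subset_range.2 hi.le) (by simpa using hi) (by simp) (hb i)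
      (fun j _ _ => (hb j).le)
  have hmono' : ∀ i, i ≤ K → rr a m i ≤ rr a m K := by
    intro i hi
    rcases hi.lt_or_eq with h | h
    · exact (hmono i h).le
    · rw [h]
  have ho : o ∈ M.euclSet n ω o (rr a m K) := by
    have := hmono 0 (by omega)
    simp only [rr, Finset.range_zero, Finset.sum_empty] at this
    simpa [SIRGModel.euclSet, rr] using this
  ext v
  constructor
  · rintro ⟨hi, hv, hr, hd⟩
    obtain ⟨p, hp⟩ := hr.exists_walk_length_eq_dist
    let q : (M.graph n ω).Walk o v :=
      p.map (SimpleGraph.Embedding.induce (M.euclSet n ω o (rr a m K))).toHom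
    refine ⟨⟨q⟩, (SimpleGraph.dist_le q).trans ?_⟩
    have : q.length = p.length := SimpleGraph.Walk.length_map _ _
    omega
  · rintro ⟨hr, hd⟩
    obtain ⟨p, hp, hpl⟩ := hr.exists_path_of_dist
    have step : ∀ i, i < p.length →
        dist (M.Y n (p.getVert i) ω) (M.Y n (p.getVert (i + 1)) ω) < a ^ (m ^ (i + 1)) := by
      intro i
      induction i using Nat.strong_induction_on with
      | _ i ih =>
        intro hi
        by_contra hcon
        rw [not_lt] at hcon
        apply H
        refine ⟨i, by omega, fun k => p.getVert k, ?_, ?_, ?_, ?_⟩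
        · intro x y hxy
          have := hp.getVert_injOn (by rw [Set.mem_ofPred]; omega)
            (by rw [Set.mem_ofPred]; omega) hxy
          exact Fin.ext this
        · simp
        · intro k
          split_ifs with hk
          · simpa using ih k.val (by omega) (by omega)
          · have : k.val = i := by omega
            simpa [this] using hcon
        · simpa using p.adj_getVert_succ hi
    have near : ∀ i, i ≤ p.length → dist (M.Y n (p.getVert i) ω) (M.Y n o ω) ≤ rr a m i ∧
        (0 < i → dist (M.Y n (p.getVert i) ω) (M.Y n o ω) < rr a m i) := by
      intro i
      induction i with
      | zero => intro _; simp [rr]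
      | succ i ih =>
        intro hi
        have h1 := (ih (by omega)).1
        have h2 := step i (by omega)
        have h3 : rr a m (i + 1) = rr a m i + a ^ (m ^ (i + 1)) := by
          simp [rr, Finset.sum_range_succ]
        have h4 := dist_triangle (M.Y n (p.getVert (i+1)) ω) (M.Y n (p.getVert i) ω) (M.Y n o ω)
        rw [dist_comm (M.Y n (p.getVert (i+1)) ω) (M.Y n (p.getVert i) ω)] at h4
        have : dist (M.Y n (p.getVert (i+1)) ω) (M.Y n o ω) < rr a m (i+1) := by linarith
        exact ⟨this.le, fun _ => this⟩
    have hs : ∀ w ∈ p.support, w ∈ M.euclSet n ω o (rr a m K) := by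
      intro w hw
      obtain ⟨i, rfl, hi⟩ := SimpleGraph.Walk.mem_support_iff_exists_getVert.1 hw
      rcases Nat.eq_zero_or_pos i with h0 | h0
      · subst h0; simpa using ho
      · exact ((near i hi).2 h0).trans_le (hmono' i (by omega))
    refine ⟨ho, hs v p.end_mem_support, ⟨⟨p.induce _ hs⟩, ?_⟩⟩
    refine (SimpleGraph.dist_le (p.induce _ hs)).trans ?_
    have : (p.induce _ hs).length = p.length := by
      have h1 := SimpleGraph.Walk.length_support (p.induce _ hs)
      have h2 := SimpleGraph.Walk.length_support p
      rw [SimpleGraph.Walk.support_induce] at h1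
      simp at h1
      omega
    omega

lemma lintegral_pi_succ {E : Type} [MeasurableSpace E] (μ : Measure E) [SigmaFinite μ] (k : ℕ)
    (F : (Fin (k + 1) → E) → ℝ≥0∞) (hF : Measurable F) :
    ∫⁻ x, F x ∂(Measure.pi fun _ : Fin (k + 1) => μ)
      = ∫⁻ p : E × (Fin k → E), F (Fin.cons p.1 p.2)
          ∂(μ.prod (Measure.pi fun _ : Fin k => μ)) := by
  have := ((measurePreserving_piFinSuccAbove (fun _ : Fin (k + 1) => μ) 0).symm)
  rw [← this.lintegral_comp hF]
  simp [MeasurableEquiv.piFinSuccAbove_symm_apply, Fin.insertNthEquiv]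

lemma measurable_finCons {E : Type} [MeasurableSpace E] (k : ℕ) :
    Measurable fun p : E × (Fin k → E) => (Fin.cons p.1 p.2 : Fin (k + 1) → E) := by
  rw [measurable_pi_iff]
  intro i
  refine Fin.cases ?_ (fun i => ?_) i
  · simpa using measurable_fst
  · simp only [Fin.cons_succ]
    fun_prop

lemma lintegral_diff_le {d : ℕ} (μ : Measure (Euc d)) [IsProbabilityMeasure μ] (c : ℝ≥0∞)
    (hμ : ∀ (f : Euc d → ℝ≥0∞), Measurable f → ∀ y, ∫⁻ x, f (y - x) ∂μ ≤ c * ∫⁻ x, f x)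
    (k : ℕ) (Φ : (Fin k → Euc d) → ℝ≥0∞) (hΦ : Measurable Φ) :
    ∫⁻ x, Φ (fun i => x i.succ - x i.castSucc) ∂(Measure.pi fun _ : Fin (k + 1) => μ)
      ≤ c ^ k * ∫⁻ z, Φ z ∂(Measure.pi fun _ : Fin k => (volume : Measure (Euc d))) := by
  induction k with
  | zero =>
    have h : ∀ z, Φ z = Φ (fun i => i.elim0) := fun z => congrArg Φ (Subsingleton.elim _ _)
    simp_rw [h]
    simp
  | succ k ih =>
    have hm1 : Measurable fun x : Fin (k + 1 + 1) → Euc d =>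
        Φ (fun i => x i.succ - x i.castSucc) := by fun_prop
    rw [lintegral_pi_succ _ _ _ hm1, lintegral_pi_succ _ _ _ hΦ]
    have hc := measurable_finCons (E := Euc d)
    have hm2 := (hm1.comp (hc _)).aemeasurable (μ := μ.prod (Measure.pi fun _ : Fin (k + 1) => μ))
    have hm3 := (hΦ.comp (hc _)).aemeasurable
      (μ := (volume : Measure (Euc d)).prod (Measure.pi fun _ : Fin k => (volume : Measure (Euc d))))
    simp only [Function.comp_def] at hm2 hm3
    rw [lintegral_prod_symm _ hm2, lintegral_prod _ hm3]
    have key : ∀ (x : Euc d) (y : Fin (k + 1) → Euc d),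
        (fun i : Fin (k + 1) => (Fin.cons x y : Fin (k + 1 + 1) → Euc d) i.succ
          - (Fin.cons x y : Fin (k + 1 + 1) → Euc d) i.castSucc)
        = Fin.cons (y 0 - x) (fun i : Fin k => y i.succ - y i.castSucc) := by
      intro x y
      funext i
      refine Fin.cases ?_ (fun i => ?_) i
      · simp
      · simp
    simp only [key]
    calc _ ≤ ∫⁻ y, c * ∫⁻ z, Φ (Fin.cons z (fun i : Fin k => y i.succ - y i.castSucc)) ∂volume
            ∂(Measure.pi fun _ : Fin (k + 1) => μ) := by
          refine lintegral_mono fun y => ?_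
          exact hμ (fun z => Φ (Fin.cons z (fun i : Fin k => y i.succ - y i.castSucc)))
            (hΦ.comp ((hc k).comp (f := fun z : Euc d =>
              (z, fun i : Fin k => y i.succ - y i.castSucc)) (by fun_prop))) _
      _ = c * ∫⁻ z, ∫⁻ y, Φ (Fin.cons z (fun i : Fin k => y i.succ - y i.castSucc))
            ∂(Measure.pi fun _ : Fin (k + 1) => μ) := by
          have hmm : Measurable fun p : (Fin (k + 1) → Euc d) × Euc d =>
              Φ (Fin.cons p.2 (fun i : Fin k => p.1 i.succ - p.1 i.castSucc)) := by
            refine hΦ.comp ((hc k).comp (f := fun p : (Fin (k + 1) → Euc d) × Euc d =>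
              (p.2, (fun i : Fin k => p.1 i.succ - p.1 i.castSucc))) (by fun_prop))
          rw [lintegral_const_mul _ (Measurable.lintegral_prod_right' hmm),
            lintegral_lintegral_swap hmm.aemeasurable]
      _ ≤ c * ∫⁻ z, c ^ k * ∫⁻ y, Φ (Fin.cons z y)
            ∂(Measure.pi fun _ : Fin k => (volume : Measure (Euc d))) := by
          gcongr with z
          exact ih (fun y => Φ (Fin.cons z y)) (hΦ.comp ((hc k).comp
            (f := fun y : Fin k → Euc d => (z, y)) (by fun_prop)))
      _ = _ := by
          have h5 := Measurable.lintegral_prod_right' (hΦ.comp (hc k))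
            (ν := Measure.pi fun _ : Fin k => (volume : Measure (Euc d)))
          simp only [Function.comp_def] at h5
          rw [lintegral_const_mul _ h5,
            ← mul_assoc, pow_succ']

lemma pi_comp_injective {ι' ι : Type} [Fintype ι] [Fintype ι'] {E : Type} [MeasurableSpace E]
    (μ : Measure E) [IsProbabilityMeasure μ] (v : ι' → ι) (hv : Function.Injective v) :
    (Measure.pi fun _ : ι => μ).map (fun y i => y (v i)) = Measure.pi fun _ : ι' => μ := by
  have h := iIndepFun_pi (μ := fun _ : ι => μ) (X := fun _ => id) (fun _ => aemeasurable_id)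
  have h2 := h.precomp hv
  have h3 := (iIndepFun_iff_map_fun_eq_pi_map (fun i => by exact (measurable_pi_apply (v i)).aemeasurable)).1 h2
  simp only [id] at h3
  rw [h3]
  congr 1
  funext i
  exact (measurePreserving_eval (fun _ : ι => μ) (v i)).map_eq

lemma volume_boxIn {d : ℕ} (hd : 1 ≤ d) (n : ℕ) : volume (boxIn d n) = n := by
  have h : boxIn d n = (MeasurableEquiv.toLp 2 (Fin d → ℝ)).symm ⁻¹'
      (Set.Icc (fun _ => -(((n : ℝ) ^ ((1 : ℝ) / d)) / 2))
        (fun _ => ((n : ℝ) ^ ((1 : ℝ) / d)) / 2)) := by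
    ext x
    simp [boxIn, Set.mem_Icc, abs_le, Pi.le_def, forall_and]
  have hv := (EuclideanSpace.volume_preserving_symm_measurableEquiv_toLp (Fin d))
  rw [h, hv.measure_preimage measurableSet_Icc.nullMeasurableSet, Real.volume_Icc_pi]
  simp only [sub_neg_eq_add, add_halves, Finset.prod_const, Finset.card_univ, Fintype.card_fin]
  rw [← ENNReal.ofReal_pow (by positivity), ← Real.rpow_natCast, ← Real.rpow_mul (by positivity)]
  have : (d : ℝ) ≠ 0 := by positivity
  rw [one_div, inv_mul_cancel₀ this]
  simp

lemma unifBox_prob {d : ℕ} (hd : 1 ≤ d) (n : ℕ) (hn : 0 < n) :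
    IsProbabilityMeasure (unifBox d n) := by
  constructor
  simp only [unifBox, Measure.smul_apply, Measure.restrict_apply_univ, volume_boxIn hd, smul_eq_mul]
  exact ENNReal.inv_mul_cancel (by simpa using hn.ne') (by simp)

lemma unifBox_le {d : ℕ} (n : ℕ) (f : Euc d → ℝ≥0∞) (y : Euc d) :
    ∫⁻ x, f (y - x) ∂(unifBox d n) ≤ (n : ℝ≥0∞)⁻¹ * ∫⁻ x, f x := by
  unfold unifBox
  rw [lintegral_smul_measure, smul_eq_mul]
  refine mul_le_mul_right ?_ _
  calc _ ≤ ∫⁻ x, f (y - x) := setLIntegral_le_lintegral _ _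
    _ = _ := lintegral_sub_left_eq_self f y

instance unif01_prob : IsProbabilityMeasure unif01 := by
  constructor
  simp [unif01]

lemma unif01_Iic (c : ℝ) : unif01 (Set.Iic c) ≤ ENNReal.ofReal c := by
  unfold unif01
  rw [Measure.restrict_apply measurableSet_Iic]
  calc _ ≤ volume (Set.Icc 0 c) := measure_mono fun x hx => ⟨hx.2.1, hx.1⟩
    _ = _ := by simp

lemma sum_last_two (n j : ℕ) (h : Fin n → Fin n → ℝ≥0∞) :
    ∑ v : Fin (j + 2) → Fin n, h (v (Fin.last j).castSucc) (v (Fin.last j).succ)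
      = (n : ℝ≥0∞) ^ j * ∑ p : Fin n × Fin n, h p.1 p.2 := by
  rw [← (Fin.snocEquiv (fun _ : Fin (j + 2) => Fin n)).sum_comp, Fintype.sum_prod_type,
    Fintype.sum_prod_type, Finset.sum_comm (s := (Finset.univ : Finset (Fin n))) (t := (Finset.univ : Finset (Fin n)))]
  rw [Finset.mul_sum]
  refine Finset.sum_congr rfl fun q _ => ?_
  simp only [Fin.snocEquiv, Equiv.coe_fn_mk, Fin.succ_last, Fin.snoc_last, Fin.snoc_castSucc]
  rw [← (Fin.snocEquiv (fun _ : Fin (j + 1) => Fin n)).sum_comp, Fintype.sum_prod_type,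
    Finset.mul_sum]
  refine Finset.sum_congr rfl fun p _ => ?_
  simp [Fin.snocEquiv]

/-- `E[κ_n(t, W_p, W_q)]` as a lower integral. -/
def gK {d : ℕ} {Ω : Type} [MeasurableSpace Ω] (M : SIRGModel d Ω) (n : ℕ) (p q : Fin n)
    (t : ℝ) : ℝ≥0∞ :=
  ∫⁻ ω, ENNReal.ofReal (M.κn n t (M.Wt n p ω) (M.Wt n q ω)) ∂M.P

lemma measurable_gK {d : ℕ} {Ω : Type} [MeasurableSpace Ω] (M : SIRGModel d Ω) (n : ℕ)
    (p q : Fin n) : Measurable (gK M n p q) := by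
  have h : Measurable fun x : ℝ × Ω =>
      ENNReal.ofReal (M.κn n x.1 (M.Wt n p x.2) (M.Wt n q x.2)) := by
    have h1 := M.Wt_meas n p
    have h2 := M.Wt_meas n q
    exact ((M.κn_meas n).comp (f := fun x : ℝ × Ω => (x.1, M.Wt n p x.2, M.Wt n q x.2))
      (by fun_prop)).ennreal_ofReal
  exact h.lintegral_prod_right'

lemma measurable_shellIndic {d : ℕ} (j : ℕ) (a m : ℝ) :
    Measurable (shellIndic (d := d) j a m) := by
  unfold shellIndic
  refine Finset.measurable_prod _ fun i _ => ?_
  split_ifs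
  · exact Measurable.ite (measurableSet_lt (by fun_prop) measurable_const)
      measurable_const measurable_const
  · exact Measurable.ite (measurableSet_le measurable_const (by fun_prop))
      measurable_const measurable_const

lemma shellIndic_le_one {d : ℕ} (j : ℕ) (a m : ℝ) (z : Fin j → Euc d) (h : shellIndic j a m z ≠ 1) :
    shellIndic j a m z = 0 := by
  by_contra h0
  apply h
  unfold shellIndic at h0 ⊢
  rw [← ne_eq, Finset.prod_ne_zero_iff] at h0
  refine Finset.prod_eq_one fun i hi => ?_
  have := h0 i hi
  split_ifs at this ⊢ <;> simp_all

lemma ofReal_expKn {d : ℕ} {Ω : Type} [MeasurableSpace Ω] (M : SIRGModel d Ω) (n : ℕ) (hn : 0 < n)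
    (t : ℝ) (ht : 0 < t) :
    ENNReal.ofReal (M.expKn n t)
      = (n : ℝ≥0∞)⁻¹ ^ 2 * ∑ p : Fin n × Fin n, gK M n p.1 p.2 t := by
  have hm : ∀ p : Fin n × Fin n,
      Measurable fun ω => M.κn n t (M.Wt n p.1 ω) (M.Wt n p.2 ω) := by
    intro p
    have h1 := M.Wt_meas n p.1
    have h2 := M.Wt_meas n p.2
    exact (M.κn_meas n).comp (f := fun ω => (t, M.Wt n p.1 ω, M.Wt n p.2 ω)) (by fun_prop)
  have hi : ∀ p : Fin n × Fin n,
      Integrable (fun ω => M.κn n t (M.Wt n p.1 ω) (M.Wt n p.2 ω)) M.P := by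
    intro p
    refine Integrable.of_bound (hm p).aestronglyMeasurable 1 (ae_of_all _ fun ω => ?_)
    rw [Real.norm_eq_abs, abs_le]
    have := M.κn_nonneg n t (M.Wt n p.1 ω) (M.Wt n p.2 ω) ht
    exact ⟨by linarith, M.κn_le_one n t _ _ ht⟩
  unfold SIRGModel.expKn gK
  rw [integral_div, integral_finsetSum _ (fun p _ => hi p), ENNReal.ofReal_div_of_pos (by positivity),
    ENNReal.ofReal_sum_of_nonneg, div_eq_mul_inv, mul_comm]
  · congr 1
    · rw [ENNReal.ofReal_pow (by positivity), ENNReal.ofReal_natCast, ENNReal.inv_pow]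
    · refine Finset.sum_congr rfl fun p _ => ?_
      exact ofReal_integral_eq_lintegral_ofReal (hi p)
        (ae_of_all _ fun ω => M.κn_nonneg n t _ _ ht)
  · intro p _
    exact integral_nonneg fun ω => M.κn_nonneg n t _ _ ht

lemma edge_index {d : ℕ} {Ω : Type} [MeasurableSpace Ω] (M : SIRGModel d Ω) (n : ℕ)
    (x y : Fin n) (hxy : x ≠ y) :
    ∃ p : {p : Fin n × Fin n // p.1 < p.2}, ∀ ω, (M.graph n ω).Adj x y →
      M.U n p.1.1 p.1.2 ω ≤
        M.κn n (dist (M.Y n x ω) (M.Y n y ω)) (M.Wt n x ω) (M.Wt n y ω) := by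
  rcases lt_or_gt_of_ne hxy with h | h
  · refine ⟨⟨(x, y), h⟩, fun ω hA => ?_⟩
    rw [SIRGModel.graph, SimpleGraph.fromRel_adj] at hA
    rcases hA.2 with h1 | h1
    · exact h1.2
    · exact absurd h1.1 h.asymm
  · refine ⟨⟨(y, x), h⟩, fun ω hA => ?_⟩
    rw [SIRGModel.graph, SimpleGraph.fromRel_adj] at hA
    rw [dist_comm, M.κn_symm]
    rcases hA.2 with h1 | h1
    · exact absurd h1.1 h.asymm
    · exact h1.2

lemma slice_le {d : ℕ} {Ω : Type} [MeasurableSpace Ω] (M : SIRGModel d Ω) (n : ℕ)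
    (x y : Fin n) (p : {p : Fin n × Fin n // p.1 < p.2}) (t : ℝ) :
    ((Measure.map (fun ω i => M.Wt n i ω) M.P).prod
      (Measure.pi fun _ : {p : Fin n × Fin n // p.1 < p.2} => unif01))
      {q | q.2 p ≤ M.κn n t (q.1 x) (q.1 y)} ≤ gK M n x y t := by
  have hk : Measurable fun w : Fin n → ℝ => M.κn n t (w x) (w y) :=
    (M.κn_meas n).comp (f := fun w : Fin n → ℝ => (t, w x, w y)) (by fun_prop)
  have hS : MeasurableSet {q : (Fin n → ℝ) × ({p : Fin n × Fin n // p.1 < p.2} → ℝ) |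
      q.2 p ≤ M.κn n t (q.1 x) (q.1 y)} :=
    measurableSet_le (by fun_prop) (hk.comp measurable_fst)
  have hW : Measurable fun ω i => M.Wt n i ω := measurable_pi_lambda _ (M.Wt_meas n)
  rw [Measure.prod_apply hS]
  unfold gK
  rw [← lintegral_map (f := fun w : Fin n → ℝ => ENNReal.ofReal (M.κn n t (w x) (w y)))
    hk.ennreal_ofReal hW]
  refine lintegral_mono fun w => ?_
  refine le_trans (le_of_eq ?_) (unif01_Iic (M.κn n t (w x) (w y)))
  have hset : Prod.mk w ⁻¹' {q : (Fin n → ℝ) × ({p : Fin n × Fin n // p.1 < p.2} → ℝ) |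
      q.2 p ≤ M.κn n t (q.1 x) (q.1 y)}
      = Function.eval p ⁻¹' Set.Iic (M.κn n t (w x) (w y)) := by
    ext u
    simp
  rw [hset]
  exact (measurePreserving_eval
    (fun _ : {p : Fin n × Fin n // p.1 < p.2} => unif01) p).measure_preimage
      measurableSet_Iic.nullMeasurableSet

lemma R_prob {d : ℕ} {Ω : Type} [MeasurableSpace Ω] (M : SIRGModel d Ω) (n : ℕ) (hn : 0 < n)
    (i : Fin n) : M.P {ω | M.R n hn 0 ω = i} ≤ (n : ℝ≥0∞)⁻¹ := by
  have h : {ω | M.R n hn 0 ω = i} ⊆ ⋃ j : Fin n, {ω | M.R n hn 0 ω = i ∧ M.R n hn 1 ω = j} := by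
    intro ω hω
    simpa using hω
  refine (measure_mono h).trans ((measure_iUnion_le _).trans ?_)
  simp only [M.R_unif, tsum_fintype, Finset.sum_const, Finset.card_univ, Fintype.card_fin,
    nsmul_eq_mul]
  have h0 : (n : ℝ≥0∞) ≠ 0 := by simpa using hn.ne'
  rw [ENNReal.mul_inv (Or.inl h0) (Or.inr h0), ← mul_assoc,
    ENNReal.mul_inv_cancel h0 (by simp), one_mul]

lemma path_prob {d : ℕ} (hd : 1 ≤ d) {Ω : Type} [MeasurableSpace Ω] (M : SIRGModel d Ω) (n : ℕ)
    (hn : 0 < n) (a m : ℝ) (j : ℕ) (v : Fin (j + 2) → Fin n) (hv : Function.Injective v) :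
    M.P {ω | M.R n hn 0 ω = v 0 ∧
        shellIndic (j + 1) a m
          (fun i => M.Y n (v i.succ) ω - M.Y n (v i.castSucc) ω) = 1 ∧
        (M.graph n ω).Adj (v (Fin.last j).castSucc) (v (Fin.last j).succ)}
      ≤ (n : ℝ≥0∞)⁻¹ ^ (j + 2) * ∫⁻ z, shellIndic (j + 1) a m z *
          gK M n (v (Fin.last j).castSucc) (v (Fin.last j).succ) ‖z (Fin.last j)‖
          ∂(Measure.pi fun _ : Fin (j + 1) => (volume : Measure (Euc d))) := by
  have := unifBox_prob hd n hn
  set x := v (Fin.last j).castSucc with hx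
  set y := v (Fin.last j).succ with hy
  have hxy : x ≠ y := by
    intro h
    have := hv h
    simp [Fin.ext_iff] at this
  obtain ⟨p, hp⟩ := edge_index M n x y hxy
  have hshm := measurable_shellIndic (d := d) (j + 1) a m
  have hWm : Measurable fun ω i => M.Wt n i ω := measurable_pi_lambda _ (M.Wt_meas n)
  have hYm : Measurable fun ω i => M.Y n i ω := measurable_pi_lambda _ (M.Y_meas n)
  -- the event in terms of the law
  let S : Set ((Fin n → Euc d) × (Fin n → ℝ) × ({p : Fin n × Fin n // p.1 < p.2} → ℝ)) :=
    {q | shellIndic (j + 1) a m (fun i => q.1 (v i.succ) - q.1 (v i.castSucc)) = 1 ∧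
      q.2.2 p ≤ M.κn n (dist (q.1 x) (q.1 y)) (q.2.1 x) (q.2.1 y)}
  have hS : MeasurableSet S := by
    refine MeasurableSet.inter ?_ ?_
    · exact (hshm.comp (f := fun q : (Fin n → Euc d) × (Fin n → ℝ) ×
        ({p : Fin n × Fin n // p.1 < p.2} → ℝ) =>
          (fun i : Fin (j + 1) => q.1 (v i.succ) - q.1 (v i.castSucc))) (by fun_prop))
          (measurableSet_singleton 1)
    · refine measurableSet_le
        ((measurable_pi_apply p).comp (measurable_snd.comp measurable_snd)) ?_
      exact (M.κn_meas n).comp (f := fun q : (Fin n → Euc d) × (Fin n → ℝ) ×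
        ({p : Fin n × Fin n // p.1 < p.2} → ℝ) =>
          (dist (q.1 x) (q.1 y), q.2.1 x, q.2.1 y)) (by fun_prop)
  let T : (Fin n → Euc d) × (Fin n → ℝ) × (Fin n → Fin n → ℝ) →
      (Fin n → Euc d) × (Fin n → ℝ) × ({p : Fin n × Fin n // p.1 < p.2} → ℝ) :=
    fun q => (q.1, q.2.1, fun p => q.2.2 p.1.1 p.1.2)
  have hT : Measurable T := by
    refine measurable_fst.prodMk ((measurable_fst.comp measurable_snd).prodMk ?_)
    refine measurable_pi_lambda _ fun p => ?_
    exact (measurable_pi_apply p.1.2).comp ((measurable_pi_apply p.1.1).comp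
      (measurable_snd.comp measurable_snd))
  have hX : Measurable fun ω =>
        ((fun i => M.Y n i ω), (fun i => M.Wt n i ω),
          (fun p : {p : Fin n × Fin n // p.1 < p.2} => M.U n p.1.1 p.1.2 ω)) :=
    hYm.prodMk (hWm.prodMk (measurable_pi_lambda _ fun p => M.U_meas n _ _))
  have hind := (M.R_indep n hn).measure_inter_preimage_eq_mul {q | q.1 = v 0} (T ⁻¹' S)
    (by measurability) (hT hS)
  have hE : M.P ((fun ω => ((fun i => M.Y n i ω), (fun i => M.Wt n i ω),
      (fun i j => M.U n i j ω))) ⁻¹' (T ⁻¹' S)) ≤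
      (n : ℝ≥0∞)⁻¹ ^ (j + 1) * ∫⁻ z, shellIndic (j + 1) a m z * gK M n x y ‖z (Fin.last j)‖
          ∂(Measure.pi fun _ : Fin (j + 1) => (volume : Measure (Euc d))) := by
    have hlaw : M.P ((fun ω => ((fun i => M.Y n i ω), (fun i => M.Wt n i ω),
      (fun i j => M.U n i j ω))) ⁻¹' (T ⁻¹' S)) = _ := (Measure.map_apply hX hS).symm
    rw [hlaw, M.joint_law n]
    have : IsProbabilityMeasure (Measure.map (fun ω i => M.Wt n i ω) M.P) :=
      Measure.isProbabilityMeasure_map hWm.aemeasurable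
    rw [Measure.prod_apply hS]
    let Φ : (Fin (j + 1) → Euc d) → ℝ≥0∞ := fun z =>
      shellIndic (j + 1) a m z * gK M n x y ‖z (Fin.last j)‖
    have hΦ : Measurable Φ := hshm.mul ((measurable_gK M n x y).comp (by fun_prop))
    have hΦ2 : Measurable fun u : Fin (j + 2) → Euc d =>
        Φ (fun i => u i.succ - u i.castSucc) := by fun_prop
    calc _ ≤ ∫⁻ q, Φ (fun i => q (v i.succ) - q (v i.castSucc))
            ∂(Measure.pi fun _ : Fin n => unifBox d n) := by
          refine lintegral_mono fun q => ?_
          by_cases hq : shellIndic (j + 1) a m (fun i => q (v i.succ) - q (v i.castSucc)) = 1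
          · simp only [Φ, hq, one_mul]
            refine le_trans (measure_mono ?_) (slice_le M n x y p _)
            intro r hr
            have := hr.2
            simp only at this
            rw [dist_comm, dist_eq_norm] at this
            exact this
          · have : Prod.mk q ⁻¹' S = ∅ := by
              ext r
              simp [S, hq]
            rw [this]
            simp
      _ = ∫⁻ u, Φ (fun i => u i.succ - u i.castSucc)
            ∂(Measure.pi fun _ : Fin (j + 2) => unifBox d n) := by
          rw [← pi_comp_injective (unifBox d n) v hv, lintegral_map hΦ2]
          exact measurable_pi_lambda _ fun i => measurable_pi_apply _
      _ ≤ _ := lintegral_diff_le (unifBox d n) _ (fun f _ y => unifBox_le n f y) _ Φ hΦ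
  calc _ ≤ M.P ((fun ω => (M.R n hn 0 ω, M.R n hn 1 ω)) ⁻¹' {q | q.1 = v 0} ∩
        (fun ω => ((fun i => M.Y n i ω), (fun i => M.Wt n i ω),
      (fun i j => M.U n i j ω))) ⁻¹' (T ⁻¹' S)) := by
        refine measure_mono ?_
        rintro ω ⟨h1, h2, h3⟩
        exact ⟨h1, h2, hp ω h3⟩
    _ ≤ (n : ℝ≥0∞)⁻¹ * _ := by
        rw [hind]
        exact mul_le_mul' (R_prob M n hn (v 0)) hE
    _ = _ := by rw [← mul_assoc, ← pow_succ']

/-- Remark: general path estimate.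
In the SIRG model, for any `m > 1`, any reals `a_n > 1` and integers `K_n ≥ 1`, with
`r_n = a_n^m + a_n^{m^2} + ⋯ + a_n^{m^{K_n}}`, for every `n ≥ 1`:
`P(K_n-ball of U_n in F^{𝔾_n}_{U_n}(r_n) ≠ K_n-ball of U_n in 𝔾_n)
  ≤ Σ_{j=1}^{K_n} ∫_{B(a_n^m)} ⋯ ∫_{B(a_n^{m^{j-1}})} ∫_{ℝ^d ∖ B(a_n^{m^j})}
      E[κ_n(‖z_j‖, W^{(n)}_{V_1}, W^{(n)}_{V_2})] dz_j ⋯ dz_1`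
(the inner sum below is reindexed so that paths of length `j` with `1 ≤ j ≤ K_n`
appear as `j + 1` with `j` ranging over `range K_n`). -/
theorem stmt7 {d : ℕ} (hd : 1 ≤ d) {Ω : Type} [MeasurableSpace Ω]
    (M : SIRGModel d Ω)
    (m : ℝ) (hm : 1 < m) (a : ℕ → ℝ) (ha : ∀ n, 1 < a n)
    (K : ℕ → ℕ) (hK : ∀ n, 1 ≤ K n) (n : ℕ) (hn : 0 < n) :
    M.P {ω |
        M.spatialBall n ω (M.R n hn 0 ω) (rr (a n) m (K n)) (K n) ≠
          graphBall (M.graph n ω) (M.R n hn 0 ω) (K n)}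
      ≤ ∑ j ∈ Finset.range (K n),
          ∫⁻ z : Fin (j + 1) → Euc d,
            shellIndic (j + 1) (a n) m z *
              ENNReal.ofReal (M.expKn n ‖z (Fin.last j)‖)
            ∂(Measure.pi fun _ : Fin (j + 1) => (volume : Measure (Euc d))) := by
  classical
  have hn0 : (n : ℝ≥0∞) ≠ 0 := by simpa using hn.ne'
  let I : ℕ → Fin n → Fin n → ℝ≥0∞ := fun j x y =>
    ∫⁻ z, shellIndic (j + 1) (a n) m z * gK M n x y ‖z (Fin.last j)‖
          ∂(Measure.pi fun _ : Fin (j + 1) => (volume : Measure (Euc d)))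
  let A : (j : ℕ) → (Fin (j + 2) → Fin n) → Set Ω := fun j v =>
    {ω | Function.Injective v ∧ M.R n hn 0 ω = v 0 ∧
        shellIndic (j + 1) (a n) m
          (fun i => M.Y n (v i.succ) ω - M.Y n (v i.castSucc) ω) = 1 ∧
        (M.graph n ω).Adj (v (Fin.last j).castSucc) (v (Fin.last j).succ)}
  have hA : ∀ j v, M.P (A j v) ≤
      (n : ℝ≥0∞)⁻¹ ^ (j + 2) * I j (v (Fin.last j).castSucc) (v (Fin.last j).succ) := by
    intro j v
    by_cases hv : Function.Injective v
    · refine le_trans (measure_mono ?_) (path_prob hd M n hn (a n) m j v hv)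
      rintro ω ⟨_, h⟩
      exact h
    · have : A j v = ∅ := by
        ext ω
        simp [A, hv]
      rw [this]
      simp
  have hsub : {ω |
        M.spatialBall n ω (M.R n hn 0 ω) (rr (a n) m (K n)) (K n) ≠
          graphBall (M.graph n ω) (M.R n hn 0 ω) (K n)}
      ⊆ ⋃ j ∈ Finset.range (K n), ⋃ v ∈ (Finset.univ : Finset (Fin (j + 2) → Fin n)), A j v := by
    intro ω hω
    by_contra hcon
    apply hω
    apply spatial_eq_of_no_jump M n ω _ (a n) m (ha n) (K n) (hK n)
    rintro ⟨j, hj, v, hinj, hv0, hsteps, hadj⟩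
    apply hcon
    simp only [Set.mem_iUnion, Finset.mem_range, Finset.mem_univ]
    refine ⟨j, hj, v, trivial, hinj, hv0.symm, ?_, hadj⟩
    unfold shellIndic
    refine Finset.prod_eq_one fun i _ => ?_
    have := hsteps i
    rw [dist_comm, dist_eq_norm] at this
    split_ifs at this ⊢ <;> simp_all
  refine (measure_mono hsub).trans ((measure_biUnion_finset_le _ _).trans ?_)
  refine Finset.sum_le_sum fun j _ => ?_
  refine (measure_biUnion_finset_le _ _).trans ((Finset.sum_le_sum fun v _ => hA j v).trans ?_)
  rw [← Finset.mul_sum, sum_last_two n j (I j), ← mul_assoc]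
  have hpow : (n : ℝ≥0∞)⁻¹ ^ (j + 2) * (n : ℝ≥0∞) ^ j = (n : ℝ≥0∞)⁻¹ ^ 2 := by
    rw [pow_add, mul_right_comm, ← mul_pow, ENNReal.inv_mul_cancel hn0 (by simp), one_pow, one_mul]
  rw [hpow]
  have hshm := measurable_shellIndic (d := d) (j + 1) (a n) m
  have hmeas : ∀ x y, Measurable fun z : Fin (j + 1) → Euc d =>
      shellIndic (j + 1) (a n) m z * gK M n x y ‖z (Fin.last j)‖ := fun x y =>
    hshm.mul ((measurable_gK M n x y).comp (by fun_prop))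
  rw [← lintegral_finsetSum _ (fun p _ => hmeas _ _), ← lintegral_const_mul _
    (Finset.measurable_sum _ fun p _ => hmeas _ _)]
  refine lintegral_mono fun z => ?_
  by_cases hz : shellIndic (j + 1) (a n) m z = 1
  · have hpos : 0 < ‖z (Fin.last j)‖ := by
      have h1 : shellIndic (j + 1) (a n) m z ≠ 0 := by rw [hz]; simp
      unfold shellIndic at h1
      rw [Finset.prod_ne_zero_iff] at h1
      have h2 := h1 (Fin.last j) (Finset.mem_univ _)
      have hb : 0 < (a n) ^ (m ^ (j + 1)) :=
        Real.rpow_pos_of_pos (by have := ha n; linarith) _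
      simp at h2
      exact hb.trans_le h2
    rw [hz, ofReal_expKn M n hn _ hpos]
    simp
  · rw [shellIndic_le_one _ _ _ _ hz]
    simp

end
end

section
/- Under Assumptions (A1) and (A2), for each n let V_0, V_1, …, V_j be i.i.d. uniform random indices on {1,…,n} independent of W^{(n)}, and let (W^{(i)})_{i ≥ 0} be i.i.d. with law F_W. Then for every integer j ≥ 1 and for Lebesgue-almost every (x_0, x_1, …, x_j) ∈ (ℝ^d)^{j+1}: E[ ∏_{i=1}^{j} κ_n(‖x_i − x_{i-1}‖, W^{(n)}_{V_{i-1}}, W^{(n)}_{V_i}) ] → E[ ∏_{i=1}^{j} κ(‖x_i − x_{i-1}‖, W^{(i-1)}, W^{(i)}) ] as n → ∞. -/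
open MeasureTheory ProbabilityTheory Filter Topology
open scoped ENNReal NNReal

noncomputable section

variable {d : ℕ} {Ω : Type} [MeasurableSpace Ω]

/-- Quantile function associated with a distribution function, zero outside `(0,1)`. -/
noncomputable def quant (F : ℝ → ℝ) (u : ℝ) : ℝ :=
  open Classical in if u ∈ Set.Ioo (0:ℝ) 1 then sInf {x | u ≤ F x} else 0

lemma quant_le_iff (μ : Measure ℝ) (u x : ℝ) (hu : u ∈ Set.Ioo (0:ℝ) 1) :
    quant (cdf μ) u ≤ x ↔ u ≤ cdf μ x := by
  have hne : {x | u ≤ cdf μ x}.Nonempty := by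
    have := (tendsto_cdf_atTop μ).eventually (lt_mem_nhds hu.2)
    obtain ⟨x, hx⟩ := this.exists
    exact ⟨x, hx.le⟩
  have hbd : BddBelow {x | u ≤ cdf μ x} := by
    have := (tendsto_cdf_atBot μ).eventually (gt_mem_nhds hu.1)
    obtain ⟨b, hb⟩ := this.exists
    refine ⟨b, fun y hy => ?_⟩
    by_contra h
    push Not at h
    exact absurd (hy.trans (monotone_cdf μ h.le)) (not_le.2 hb)
  have hmem : u ≤ cdf μ (sInf {x | u ≤ cdf μ x}) := by
    have hrc := (cdf μ).right_continuous (sInf {x | u ≤ cdf μ x})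
    have hrc' : ContinuousWithinAt (cdf μ) (Set.Ioi (sInf {x | u ≤ cdf μ x}))
      (sInf {x | u ≤ cdf μ x}) := hrc.mono Set.Ioi_subset_Ici_self
    refine ge_of_tendsto hrc' ?_
    filter_upwards [self_mem_nhdsWithin] with y hy
    obtain ⟨z, hz, hzy⟩ := exists_lt_of_csInf_lt hne hy
    exact le_trans hz (monotone_cdf μ hzy.le)
  rw [quant, if_pos hu]
  constructor
  · intro h
    exact hmem.trans (monotone_cdf μ h)
  · intro h
    exact csInf_le hbd h

lemma measurable_quant {α : Type*} [MeasurableSpace α] (μ : α → Measure ℝ)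
    (hμ : ∀ x, Measurable fun a => cdf (μ a) x) (f : α → ℝ) (hf : Measurable f) :
    Measurable fun a => quant (cdf (μ a)) (f a) := by
  refine measurable_of_Iic fun x => ?_
  have : (fun a => quant (cdf (μ a)) (f a)) ⁻¹' Set.Iic x =
      ({a | f a ∈ Set.Ioo (0:ℝ) 1} ∩ {a | f a ≤ cdf (μ a) x}) ∪
      ({a | f a ∈ Set.Ioo (0:ℝ) 1}ᶜ ∩ {_a | 0 ≤ x}) := by
    ext a
    by_cases h : f a ∈ Set.Ioo (0:ℝ) 1
    · simp only [Set.mem_preimage, Set.mem_Iic, quant_le_iff _ _ _ h]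
      simp only [Set.mem_union, Set.mem_inter_iff, Set.mem_ofPred_eq, Set.mem_compl_iff, h]
      simp
    · simp only [Set.mem_preimage, Set.mem_Iic, quant, if_neg h]
      simp only [Set.mem_union, Set.mem_inter_iff, Set.mem_ofPred_eq, Set.mem_compl_iff, h]
      simp
  rw [this]
  have h1 : MeasurableSet {a | f a ∈ Set.Ioo (0:ℝ) 1} := hf measurableSet_Ioo
  exact (h1.inter (measurableSet_le hf (hμ x))).union (h1.compl.inter (MeasurableSet.const _))

/-- Uniform measure on `(0,1)`. -/
noncomputable def lamU : Measure ℝ := volume.restrict (Set.Ioo 0 1)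

instance : IsProbabilityMeasure lamU := ⟨by simp [lamU]⟩

lemma measurable_quant' (μ : Measure ℝ) : Measurable (quant (cdf μ)) :=
  measurable_quant (fun _ => μ) (fun _ => measurable_const) id measurable_id

lemma map_quant (μ : Measure ℝ) [IsProbabilityMeasure μ] :
    Measure.map (quant (cdf μ)) lamU = μ := by
  have hm := measurable_quant' μ
  have : IsProbabilityMeasure (Measure.map (quant (cdf μ)) lamU) :=
    Measure.isProbabilityMeasure_map hm.aemeasurable
  refine Measure.ext_of_Iic _ _ fun x => ?_
  rw [Measure.map_apply hm measurableSet_Iic, lamU,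
    Measure.restrict_apply (hm measurableSet_Iic), ← ofReal_cdf]
  have h0 := cdf_nonneg μ x
  have h1 := cdf_le_one μ x
  apply le_antisymm
  · calc _ ≤ volume (Set.Ioc 0 (cdf μ x)) := by
          apply measure_mono
          rintro u ⟨hu1, hu2⟩
          exact ⟨hu2.1, (quant_le_iff μ u x hu2).1 hu1⟩
      _ = _ := by simp
  · calc _ = volume (Set.Ioo 0 (cdf μ x)) := by simp
      _ ≤ _ := by
          apply measure_mono
          rintro u ⟨hu1, hu2⟩
          have hu : u ∈ Set.Ioo (0:ℝ) 1 := ⟨hu1, hu2.trans_le h1⟩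
          exact ⟨(quant_le_iff μ u x hu).2 hu2.le, hu⟩

lemma quant_tendsto (μn : ℕ → Measure ℝ) (μ : Measure ℝ) (S : Set ℝ) (hS : Dense S)
    (h : ∀ q ∈ S, Tendsto (fun n => cdf (μn n) q) atTop (𝓝 (cdf μ q)))
    (u : ℝ) (hu : u ∈ Set.Ioo (0:ℝ) 1) (hu' : ∀ q ∈ S, cdf μ q ≠ u) :
    Tendsto (fun n => quant (cdf (μn n)) u) atTop (𝓝 (quant (cdf μ) u)) := by
  rw [tendsto_order]
  constructor
  · intro a ha
    obtain ⟨q, hq, haq, hqu⟩ := hS.exists_between ha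
    have : cdf μ q < u := by
      by_contra hh
      exact absurd ((quant_le_iff μ u q hu).2 (not_lt.1 hh)) (not_le.2 hqu)
    filter_upwards [(h q hq).eventually (gt_mem_nhds this)] with n hn
    by_contra hh
    have := (quant_le_iff (μn n) u q hu).1 ((not_lt.1 hh).trans haq.le)
    linarith
  · intro a ha
    obtain ⟨q, hq, haq, hqu⟩ := hS.exists_between ha
    have : u < cdf μ q := lt_of_le_of_ne ((quant_le_iff μ u q hu).1 haq.le) (hu' q hq).symm
    filter_upwards [(h q hq).eventually (lt_mem_nhds this)] with n hn
    exact ((quant_le_iff (μn n) u q hu).2 hn.le).trans_lt hqu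

lemma ae_norm_of_ae {d : ℕ} (hd : 1 ≤ d) {p : ℝ → Prop} (hp : ∀ᵐ t ∂(volume : Measure ℝ), p t) :
    ∀ᵐ y : EuclideanSpace ℝ (Fin d), p ‖y‖ := by
  have : Nonempty (Fin d) := ⟨⟨0, hd⟩⟩
  obtain ⟨N, hN, hNm, hN0⟩ := exists_measurable_superset_of_null hp
  have hz : (fun y : ℝ ↦ y ^ (Module.finrank ℝ (EuclideanSpace ℝ (Fin d)) - 1) •
      N.indicator (fun _ => (1:ℝ)) y) =ᵐ[volume.restrict (Set.Ioi 0)] 0 := by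
    apply ae_restrict_of_ae
    have : ∀ᵐ t, t ∉ N := measure_eq_zero_iff_ae_notMem.1 hN0
    filter_upwards [this] with t ht
    simp [ht]
  have hIntg : Integrable (fun y : EuclideanSpace ℝ (Fin d) => N.indicator (fun _ => (1:ℝ)) ‖y‖)
      volume := by
    rw [integrable_fun_norm_addHaar volume (f := N.indicator (fun _ => (1:ℝ)))]
    exact (integrable_zero _ _ _).congr hz.symm
  have h0 : ∫ y : EuclideanSpace ℝ (Fin d), N.indicator (fun _ => (1:ℝ)) ‖y‖ = 0 := by
    rw [integral_fun_norm_addHaar, integral_congr_ae hz]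
    simp
  rw [integral_eq_zero_iff_of_nonneg (fun y => Set.indicator_nonneg (fun _ _ => zero_le_one) _) hIntg] at h0
  filter_upwards [h0] with y hy
  by_contra hc
  have : ‖y‖ ∈ N := hN hc
  simp [this] at hy

lemma ae_dist_of_ae {d j : ℕ} (hd : 1 ≤ d) (a b : Fin (j+1)) (hab : a ≠ b) {p : ℝ → Prop}
    (hp : ∀ᵐ t ∂(volume : Measure ℝ), p t) :
    ∀ᵐ x : Fin (j + 1) → EuclideanSpace ℝ (Fin d)
      ∂(Measure.pi fun _ : Fin (j + 1) => (volume : Measure (EuclideanSpace ℝ (Fin d)))),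
      p (dist (x a) (x b)) := by
  have h1 := ae_norm_of_ae hd hp
  obtain ⟨N, hN, hNm, hN0⟩ := exists_measurable_superset_of_null h1
  let L : (Fin (j + 1) → EuclideanSpace ℝ (Fin d)) →ₗ[ℝ] EuclideanSpace ℝ (Fin d) :=
    { toFun := fun x => x a - x b
      map_add' := by intro x y; simp only [Pi.add_apply]; abel
      map_smul' := by intro c x; simp [smul_sub] }
  have hL : Function.Surjective L := by
    intro y
    refine ⟨Function.update 0 a y, ?_⟩
    simp [L, hab.symm]
  have := (ae_comp_linearMap_mem_iff L (Measure.pi fun _ : Fin (j + 1) =>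
    (volume : Measure (EuclideanSpace ℝ (Fin d)))) volume hL hNm.compl).2
    (measure_eq_zero_iff_ae_notMem.1 hN0)
  filter_upwards [this] with x hx
  by_contra hc
  rw [dist_eq_norm] at hc
  exact hx (hN hc)

lemma exists_good {Ω : Type*} [MeasurableSpace Ω] (P : Measure Ω) [IsProbabilityMeasure P]
    (Z : ℕ → ℕ → Ω → ℝ) (hZ : ∀ k n, Measurable (Z k n))
    (h : ∀ k, TendstoInMeasure P (Z k) atTop (fun _ => 0)) :
    ∃ G : ℕ → Set Ω, (∀ n, MeasurableSet (G n)) ∧ Tendsto (fun n => P (G n)ᶜ) atTop (𝓝 0) ∧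
      ∀ ε > 0, ∀ k, ∀ᶠ n in atTop, ∀ ω ∈ G n, |Z k n ω| < ε := by
  classical
  let E : ℕ → ℕ → Set Ω := fun m n => ⋃ k ∈ Finset.range (m+1), {ω | (1:ℝ)/(m+1) ≤ ‖Z k n ω - 0‖}
  have hE : ∀ m n, MeasurableSet (E m n) := fun m n =>
    Finset.measurableSet_biUnion _ fun k _ =>
      measurableSet_le measurable_const ((hZ k n).sub measurable_const).norm
  have hE0 : ∀ m, Tendsto (fun n => P (E m n)) atTop (𝓝 0) := by
    intro m
    have h2 : Tendsto (fun n => ∑ k ∈ Finset.range (m+1),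
        P {ω | (1:ℝ)/(m+1) ≤ ‖Z k n ω - 0‖}) atTop (𝓝 (∑ k ∈ Finset.range (m+1), 0)) := by
      refine tendsto_finsetSum _ fun k _ => ?_
      exact (tendstoInMeasure_iff_norm.1 (h k)) _ (by positivity)
    rw [Finset.sum_const_zero] at h2
    exact tendsto_of_tendsto_of_tendsto_of_le_of_le tendsto_const_nhds h2
      (fun _ => zero_le) (fun n => measure_biUnion_finset_le _ _)
  let Q : ℕ → ℕ → Prop := fun n m => P (E m n) ≤ ((m:ℝ≥0∞)+1)⁻¹
  let φ : ℕ → ℕ := fun n => Nat.findGreatest (Q n) n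
  have hQ0 : ∀ n, Q n 0 := fun n => by simpa [Q] using prob_le_one
  have hQφ : ∀ n, Q n (φ n) := fun n => Nat.findGreatest_spec (Nat.zero_le n) (hQ0 n)
  have hφ : Tendsto φ atTop atTop := by
    refine tendsto_atTop.2 fun m => ?_
    have : ∀ᶠ n in atTop, Q n m := by
      have hpos : (0:ℝ≥0∞) < ((m:ℝ≥0∞)+1)⁻¹ := by
        rw [ENNReal.inv_pos]
        exact ENNReal.add_ne_top.2 ⟨ENNReal.natCast_ne_top m, ENNReal.one_ne_top⟩
      filter_upwards [(hE0 m).eventually (gt_mem_nhds hpos)] with n h1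
      exact h1.le
    filter_upwards [this, eventually_ge_atTop m] with n h1 h2
    exact Nat.le_findGreatest h2 h1
  refine ⟨fun n => (E (φ n) n)ᶜ, fun n => (hE _ _).compl, ?_, ?_⟩
  · simp only [compl_compl]
    have h3 : Tendsto (fun m : ℕ => ((m:ℝ≥0∞)+1)⁻¹) atTop (𝓝 0) := by
      have := (tendsto_add_atTop_iff_nat 1).2 ENNReal.tendsto_inv_nat_nhds_zero
      simpa using this
    exact tendsto_of_tendsto_of_tendsto_of_le_of_le tendsto_const_nhds (h3.comp hφ)
      (fun _ => zero_le) hQφ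
  · intro ε hε k
    have h4 : Tendsto (fun n => (1:ℝ)/((φ n : ℝ)+1)) atTop (𝓝 0) :=
      tendsto_one_div_add_atTop_nhds_zero_nat.comp hφ
    filter_upwards [h4.eventually (gt_mem_nhds hε), hφ.eventually_ge_atTop k] with n h5 h6 ω hω
    simp only [E, Set.mem_compl_iff, Set.mem_iUnion, not_exists] at hω
    have := hω k (Finset.mem_range.2 (by omega))
    simp only [Set.mem_ofPred_eq, sub_zero, not_le, Real.norm_eq_abs] at this
    linarith

/-- Empirical measure of a finite vector. -/
noncomputable def empM (n : ℕ) (w : Fin n → ℝ) : Measure ℝ :=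
  Measure.map w ((n:ℝ≥0∞)⁻¹ • Measure.count)

lemma prob_unif (n : ℕ) (hn : 0 < n) :
    IsProbabilityMeasure ((n:ℝ≥0∞)⁻¹ • (Measure.count : Measure (Fin n))) := by
  constructor
  simp only [Measure.smul_apply, smul_eq_mul, Measure.count_univ]
  rw [ENat.card_eq_coe_fintype_card]
  simp only [Fintype.card_fin]
  exact ENNReal.inv_mul_cancel (by simp; omega) (by simp)

lemma prob_empM (n : ℕ) (hn : 0 < n) (w : Fin n → ℝ) : IsProbabilityMeasure (empM n w) := by
  have := prob_unif n hn
  exact Measure.isProbabilityMeasure_map (measurable_of_finite _).aemeasurable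

lemma cdf_empM (n : ℕ) (hn : 0 < n) (w : Fin n → ℝ) (x : ℝ) :
    cdf (empM n w) x = (∑ i : Fin n, indic (w i ≤ x)) / n := by
  classical
  have := prob_empM n hn w
  rw [cdf_eq_real, measureReal_def, empM, Measure.map_apply (measurable_of_finite _) measurableSet_Iic]
  simp only [Measure.smul_apply, smul_eq_mul]
  rw [Measure.count_apply_finite _ (Set.toFinite _), ENNReal.toReal_mul, ENNReal.toReal_inv]
  simp only [ENNReal.toReal_natCast]
  simp only [indic]
  rw [Finset.sum_boole, div_eq_inv_mul]
  congr 3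
  ext i
  simp

lemma integral_pi_empM (n : ℕ) (hn : 0 < n) (w : Fin n → ℝ) (k : ℕ) (f : (Fin k → ℝ) → ℝ)
    (hf : Measurable f) :
    ∫ z, f z ∂(Measure.pi fun _ : Fin k => empM n w) =
      (∑ v : Fin k → Fin n, f (fun i => w (v i))) / (n:ℝ)^k := by
  have := prob_unif n hn
  have := prob_empM n hn w
  have h1 : (Measure.pi fun _ : Fin k => empM n w) = Measure.map (fun v i => w (v i))
      (Measure.pi fun _ : Fin k => ((n:ℝ≥0∞)⁻¹ • (Measure.count : Measure (Fin n)))) := by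
    symm
    exact Measure.pi_map_pi (fun _ => (measurable_of_finite w).aemeasurable)
  rw [h1, integral_map (measurable_of_finite _).aemeasurable hf.aestronglyMeasurable,
    integral_fintype (Integrable.of_finite), Finset.sum_div]
  refine Finset.sum_congr rfl fun v _ => ?_
  rw [measureReal_def, Measure.pi_singleton]
  simp [div_eq_inv_mul]

lemma integral_pi_quant (μ : Measure ℝ) [IsProbabilityMeasure μ] (k : ℕ) (f : (Fin k → ℝ) → ℝ)
    (hf : Measurable f) :
    ∫ u, f (fun i => quant (cdf μ) (u i)) ∂(Measure.pi fun _ : Fin k => lamU) =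
      ∫ z, f z ∂(Measure.pi fun _ : Fin k => μ) := by
  have hm := measurable_quant' μ
  have h1 : (Measure.pi fun _ : Fin k => μ) = Measure.map (fun u i => quant (cdf μ) (u i))
      (Measure.pi fun _ : Fin k => lamU) := by
    symm
    have : IsProbabilityMeasure (Measure.map (quant (cdf μ)) lamU) :=
      Measure.isProbabilityMeasure_map hm.aemeasurable
    rw [Measure.pi_map_pi (fun _ => hm.aemeasurable), map_quant]
  have hm2 : Measurable fun (u : Fin k → ℝ) i => quant (cdf μ) (u i) :=
    measurable_pi_lambda _ fun i => hm.comp (measurable_pi_apply i)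
  rw [h1, integral_map hm2.aemeasurable hf.aestronglyMeasurable]

/-- Convergence of path expectations.
Under Assumptions (A1)–(A2), for every `j ≥ 1` and Lebesgue-almost every
`(x_0, …, x_j) ∈ (ℝ^d)^{j+1}`:
`E[∏_{i=1}^{j} κ_n(‖x_i − x_{i-1}‖, W^{(n)}_{V_{i-1}}, W^{(n)}_{V_i})]
  → E[∏_{i=1}^{j} κ(‖x_i − x_{i-1}‖, W^{(i-1)}, W^{(i)})]` as `n → ∞`, where
`V_0, …, V_j` are i.i.d. uniform indices on `[n]` independent of `W^{(n)}`, and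
`(W^{(i)})_{i≥0}` are i.i.d. with law `F_W`. -/
theorem stmt14 {d : ℕ} (hd : 1 ≤ d) {Ω : Type} [MeasurableSpace Ω]
    (M : SIRGModel d Ω) (A : SIRGWeakAssumptions M) (j : ℕ) (hj : 1 ≤ j) :
    ∀ᵐ x : Fin (j + 1) → Euc d
      ∂(Measure.pi fun _ : Fin (j + 1) => (volume : Measure (Euc d))),
      Tendsto (fun n : ℕ => M.pathExp n j x) atTop (𝓝 (Wfun d A.κ A.μW j x)) := by
  classical
  have := A.probμW
  set μ := A.μW with hμdef
  -- countable dense set of continuity points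
  have hatoms : {x : ℝ | μ {x} ≠ 0}.Countable := by
    have := Measure.countable_meas_pos_of_disjoint_iUnion (μ := μ) (As := fun x : ℝ => {x})
      (fun x => measurableSet_singleton x)
      (fun x y hxy => Set.disjoint_singleton.2 hxy)
    simpa [pos_iff_ne_zero] using this
  have hdense : Dense {x : ℝ | μ {x} ≠ 0}ᶜ := hatoms.dense_compl ℝ
  obtain ⟨S, hSsub, hScount, hSdense, -⟩ := hdense.exists_countable_dense_subset_no_bot_top
  obtain ⟨q, hq⟩ := hScount.exists_eq_range hSdense.nonempty
  -- empirical measures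
  let em : (n : ℕ) → Ω → Measure ℝ := fun n ω => empM n (fun i => M.Wt n i ω)
  have hcdfm : ∀ n x, Measurable fun ω => cdf (em n ω) x := by
    intro n x
    rcases Nat.eq_zero_or_pos n with rfl | hn
    · have : (fun ω => cdf (em 0 ω) x) = fun _ => cdf (empM 0 (fun _ => 0)) x := by
        funext ω
        simp only [em]
        congr 3
        exact Subsingleton.elim _ _
      rw [this]
      exact measurable_const
    · simp only [em, cdf_empM n hn, indic]
      refine Measurable.div_const (Finset.measurable_sum _ fun i _ => ?_) _
      exact Measurable.ite (measurableSet_le (M.Wt_meas n i) measurable_const)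
        measurable_const measurable_const
  obtain ⟨G, hGm, hG0, hG⟩ := exists_good M.P
    (fun k n ω => cdf (em n ω) (q k) - cdf μ (q k))
    (fun k n => (hcdfm n (q k)).sub measurable_const) (by
      intro k
      have hk : μ {q k} = 0 := by
        have : q k ∈ S := hq ▸ Set.mem_range_self k
        have := hSsub this
        simpa using this
      have h := A.weights_conv (q k) hk
      rw [tendstoInMeasure_iff_norm] at h ⊢
      intro ε hε
      refine (h ε hε).congr' ?_
      filter_upwards [eventually_gt_atTop 0] with n hn
      congr 1
      ext ω
      simp only [Set.mem_ofPred_eq, em]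
      rw [cdf_empM n hn, cdf_eq_real, sub_zero, measureReal_def])
  -- the coupling space
  let ν : Measure ((ℕ → Ω) × (Fin (j+1) → ℝ)) :=
    (Measure.infinitePi (fun _ : ℕ => M.P)).prod (Measure.pi fun _ : Fin (j+1) => lamU)
  let Xh : ℕ → Fin (j+1) → ((ℕ → Ω) × (Fin (j+1) → ℝ)) → ℝ :=
    fun n k θ => quant (cdf (em n (θ.1 n))) (θ.2 k)
  let X0 : Fin (j+1) → ((ℕ → Ω) × (Fin (j+1) → ℝ)) → ℝ :=
    fun k θ => quant (cdf μ) (θ.2 k)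
  let X : ℕ → Fin (j+1) → ((ℕ → Ω) × (Fin (j+1) → ℝ)) → ℝ :=
    fun n k θ => if θ.1 n ∈ G n then Xh n k θ else X0 k θ
  have hX0m : ∀ k, Measurable (X0 k) := fun k =>
    (measurable_quant' μ).comp ((measurable_pi_apply k).comp measurable_snd)
  have hXhm : ∀ n k, Measurable (Xh n k) := by
    intro n k
    refine measurable_quant (fun θ : (ℕ → Ω) × (Fin (j+1) → ℝ) => em n (θ.1 n)) (fun x => ?_) _
      ((measurable_pi_apply k).comp measurable_snd)
    exact (hcdfm n x).comp ((measurable_pi_apply n).comp measurable_fst)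
  have hGm' : ∀ n, MeasurableSet {θ : (ℕ → Ω) × (Fin (j+1) → ℝ) | θ.1 n ∈ G n} := fun n =>
    ((measurable_pi_apply n).comp measurable_fst) (hGm n)
  have hXm : ∀ n k, Measurable (X n k) := fun n k =>
    Measurable.ite (hGm' n) (hXhm n k) (hX0m k)
  have hXconv : ∀ᵐ θ ∂ν, ∀ k, Tendsto (fun n => X n k θ) atTop (𝓝 (X0 k θ)) := by
    rw [ae_all_iff]
    intro k
    have hlam : ∀ᵐ u ∂lamU, u ∈ Set.Ioo (0:ℝ) 1 ∧ u ∉ (fun y => cdf μ y) '' S := by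
      refine (ae_restrict_mem measurableSet_Ioo).and ?_
      refine ae_restrict_of_ae ?_
      exact measure_eq_zero_iff_ae_notMem.1 ((hScount.image _).measure_zero _)
    have h1 : ∀ᵐ u ∂(Measure.pi fun _ : Fin (j+1) => lamU),
        u k ∈ Set.Ioo (0:ℝ) 1 ∧ u k ∉ (fun y => cdf μ y) '' S :=
      (measurePreserving_eval (fun _ : Fin (j+1) => lamU) k).quasiMeasurePreserving.ae hlam
    have h2 : ∀ᵐ θ ∂ν, θ.2 k ∈ Set.Ioo (0:ℝ) 1 ∧ θ.2 k ∉ (fun y => cdf μ y) '' S :=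
      Measure.quasiMeasurePreserving_snd.ae h1
    filter_upwards [h2] with θ hθ
    have hrw : ∀ n, X n k θ = quant (cdf (if θ.1 n ∈ G n then em n (θ.1 n) else μ)) (θ.2 k) := by
      intro n
      simp only [X, Xh, X0]
      split_ifs <;> rfl
    simp only [hrw]
    refine quant_tendsto _ μ S hSdense ?_ _ hθ.1 (fun y hy h => hθ.2 ⟨y, hy, h⟩)
    intro y hy
    rw [hq] at hy
    obtain ⟨m, rfl⟩ := hy
    rw [Metric.tendsto_nhds]
    intro ε hε
    filter_upwards [hG ε hε m] with n hn
    split_ifs with hin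
    · rw [Real.dist_eq]
      exact hn _ hin
    · simpa using hε
  -- exchange of almost everywhere quantifiers
  have hswap : ∀ i : Fin j, ∀ᵐ x : Fin (j + 1) → Euc d
      ∂(Measure.pi fun _ : Fin (j + 1) => (volume : Measure (Euc d))), ∀ᵐ θ ∂ν,
      Tendsto (fun n => M.κn n (dist (x i.succ) (x i.castSucc)) (X n i.castSucc θ) (X n i.succ θ))
        atTop (𝓝 (A.κ (dist (x i.succ) (x i.castSucc)) (X0 i.castSucc θ) (X0 i.succ θ))) := by
    intro i
    rw [Measure.ae_ae_comm]
    · filter_upwards [hXconv] with θ hθ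
      have h1 := A.κ_conv _ _ _ _ (hθ i.castSucc) (hθ i.succ)
      have h2 : ∀ᵐ t : ℝ, t ≠ 0 := by
        have : ∀ᵐ t : ℝ, t ∉ ({0} : Set ℝ) := measure_eq_zero_iff_ae_notMem.1 (by simp)
        simpa using this
      have h3 := ae_dist_of_ae hd i.succ i.castSucc (Fin.castSucc_lt_succ).ne' (h1.and h2)
      filter_upwards [h3] with x hx
      exact hx.1 (lt_of_le_of_ne dist_nonneg hx.2.symm)
    · have hdm : Measurable fun z : (Fin (j + 1) → Euc d) × ((ℕ → Ω) × (Fin (j+1) → ℝ)) =>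
          dist (z.1 i.succ) (z.1 i.castSucc) :=
        Measurable.dist ((measurable_pi_apply _).comp measurable_fst)
          ((measurable_pi_apply _).comp measurable_fst)
      refine measurableSet_tendsto_fun (fun n => ?_) ?_
      · exact (M.κn_meas n).comp (hdm.prodMk (((hXm n _).comp measurable_snd).prodMk
          ((hXm n _).comp measurable_snd)))
      · exact A.κ_meas.comp (hdm.prodMk (((hX0m _).comp measurable_snd).prodMk
          ((hX0m _).comp measurable_snd)))
  have hpos : ∀ i : Fin j, ∀ᵐ x : Fin (j + 1) → Euc d
      ∂(Measure.pi fun _ : Fin (j + 1) => (volume : Measure (Euc d))),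
      0 < dist (x i.succ) (x i.castSucc) := by
    intro i
    have h2 : ∀ᵐ t : ℝ, t ≠ 0 := by
      have : ∀ᵐ t : ℝ, t ∉ ({0} : Set ℝ) := measure_eq_zero_iff_ae_notMem.1 (by simp)
      simpa using this
    filter_upwards [ae_dist_of_ae hd i.succ i.castSucc (Fin.castSucc_lt_succ).ne' h2] with x hx
    exact lt_of_le_of_ne dist_nonneg hx.symm
  filter_upwards [ae_all_iff.2 hswap, ae_all_iff.2 hpos] with x hx ht
  rw [← ae_all_iff] at hx
  let t : Fin j → ℝ := fun i => dist (x i.succ) (x i.castSucc)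
  let fn : ℕ → (Fin (j+1) → ℝ) → ℝ := fun n w => ∏ i : Fin j, M.κn n (t i) (w i.castSucc) (w i.succ)
  let f : (Fin (j+1) → ℝ) → ℝ := fun w => ∏ i : Fin j, A.κ (t i) (w i.castSucc) (w i.succ)
  have hfnm : ∀ n, Measurable (fn n) := fun n => Finset.measurable_prod _ fun i _ =>
    (M.κn_meas n).comp (g := fun p : ℝ × ℝ × ℝ => M.κn n p.1 p.2.1 p.2.2)
      (f := fun w : Fin (j+1) → ℝ => (t i, w i.castSucc, w i.succ)) (by fun_prop)
  have hfm : Measurable f := Finset.measurable_prod _ fun i _ =>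
    A.κ_meas.comp (g := fun p : ℝ × ℝ × ℝ => A.κ p.1 p.2.1 p.2.2)
      (f := fun w : Fin (j+1) → ℝ => (t i, w i.castSucc, w i.succ)) (by fun_prop)
  have hfn0 : ∀ n w, 0 ≤ fn n w := fun n w => Finset.prod_nonneg fun i _ =>
    M.κn_nonneg _ _ _ _ (ht i)
  have hfn1 : ∀ n w, fn n w ≤ 1 := fun n w => Finset.prod_le_one
    (fun i _ => M.κn_nonneg _ _ _ _ (ht i)) (fun i _ => M.κn_le_one _ _ _ _ (ht i))
  have hnorm : ∀ n w, ‖fn n w‖ ≤ 1 := fun n w => by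
    rw [Real.norm_of_nonneg (hfn0 n w)]
    exact hfn1 n w
  have hconv : ∀ᵐ θ ∂ν, Tendsto (fun n => fn n (fun k => X n k θ)) atTop
      (𝓝 (f (fun k => X0 k θ))) := by
    filter_upwards [hx] with θ hθ
    exact tendsto_finsetProd _ fun i _ => hθ i
  have hWf : Wfun d A.κ A.μW j x = ∫ w, f w ∂(Measure.pi fun _ : Fin (j+1) => μ) := rfl
  have hpe : ∀ n, M.pathExp n j x = ∫ ω, (∑ v : Fin (j+1) → Fin n,
      fn n (fun k => M.Wt n (v k) ω)) / (n:ℝ)^(j+1) ∂M.P := fun n => rfl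
  clear_value fn f
  have hXm' : ∀ n, Measurable fun θ => fn n (fun k => X n k θ) := fun n =>
    (hfnm n).comp (measurable_pi_lambda _ (hXm n))
  have hXhm' : ∀ n, Measurable fun θ => fn n (fun k => Xh n k θ) := fun n =>
    (hfnm n).comp (measurable_pi_lambda _ (hXhm n))
  have hDCT : Tendsto (fun n => ∫ θ, fn n (fun k => X n k θ) ∂ν) atTop
      (𝓝 (∫ θ, f (fun k => X0 k θ) ∂ν)) := by
    refine tendsto_integral_of_dominated_convergence (fun _ => 1)
      (fun n => (hXm' n).aestronglyMeasurable) (integrable_const _)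
      (fun n => ae_of_all _ fun θ => ?_) ?_
    · exact hnorm _ _
    · exact hconv
  have hlim : ∫ θ, f (fun k => X0 k θ) ∂ν = Wfun d A.κ A.μW j x := by
    have h1 : ∫ θ, f (fun k => X0 k θ) ∂ν =
        ∫ u, f (fun k => quant (cdf μ) (u k)) ∂(Measure.pi fun _ : Fin (j+1) => lamU) := by
      have := integral_fun_snd (μ := Measure.infinitePi (fun _ : ℕ => M.P))
        (ν := Measure.pi fun _ : Fin (j+1) => lamU) (fun u => f (fun k => quant (cdf μ) (u k)))
      simpa [ν, X0] using this
    rw [h1, integral_pi_quant μ (j+1) f hfm, hWf]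
  have hpath : ∀ n, 0 < n → M.pathExp n j x = ∫ θ, fn n (fun k => Xh n k θ) ∂ν := by
    intro n hn
    have hIntg : Integrable (fun θ => fn n (fun k => Xh n k θ)) ν := by
      refine Integrable.of_bound (hXhm' n).aestronglyMeasurable 1 (ae_of_all _ fun θ => ?_)
      exact hnorm _ _
    rw [integral_prod _ hIntg]
    have h1 : ∀ ω : ℕ → Ω, ∫ u, fn n (fun k => Xh n k (ω, u))
        ∂(Measure.pi fun _ : Fin (j+1) => lamU) =
        (∑ v : Fin (j+1) → Fin n, fn n (fun k => M.Wt n (v k) (ω n))) / (n:ℝ)^(j+1) := by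
      intro ω
      have := prob_empM n hn (fun i => M.Wt n i (ω n))
      exact (integral_pi_quant (empM n (fun i => M.Wt n i (ω n))) (j+1) (fn n) (hfnm n)).trans
        (integral_pi_empM n hn (fun i => M.Wt n i (ω n)) (j+1) (fn n) (hfnm n))
    simp only [h1]
    have hgm : Measurable fun ω : Ω =>
        (∑ v : Fin (j+1) → Fin n, fn n (fun k => M.Wt n (v k) ω)) / (n:ℝ)^(j+1) :=
      Measurable.div_const (Finset.measurable_sum _ fun v _ =>
        (hfnm n).comp (measurable_pi_lambda _ fun k => M.Wt_meas n (v k))) _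
    have h2 := integral_map (μ := Measure.infinitePi (fun _ : ℕ => M.P))
      (measurable_pi_apply n).aemeasurable (hgm.aestronglyMeasurable)
    have h3 : Measure.map (fun ω : ℕ → Ω => ω n) (Measure.infinitePi (fun _ : ℕ => M.P)) = M.P :=
      Measure.infinitePi_map_eval (fun _ : ℕ => M.P) n
    rw [h3] at h2
    rw [hpe]
    exact h2
  have hdiff : Tendsto (fun n => M.pathExp n j x - ∫ θ, fn n (fun k => X n k θ) ∂ν) atTop (𝓝 0) := by
    have hG0' : Tendsto (fun n => (M.P (G n)ᶜ).toReal) atTop (𝓝 0) := by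
      have := (ENNReal.tendsto_toReal ENNReal.zero_ne_top).comp hG0
      rwa [ENNReal.toReal_zero] at this
    refine squeeze_zero_norm' ?_ hG0'
    filter_upwards [eventually_gt_atTop 0] with n hn
    have hb : ∀ (Y : Fin (j+1) → ((ℕ → Ω) × (Fin (j+1) → ℝ)) → ℝ),
        Measurable (fun θ => fn n (fun k => Y k θ)) →
        Integrable (fun θ => fn n (fun k => Y k θ)) ν := by
      intro Y hY
      refine Integrable.of_bound hY.aestronglyMeasurable 1 (ae_of_all _ fun θ => ?_)
      exact hnorm _ _
    rw [hpath n hn, ← integral_sub (hb _ (hXhm' n)) (hb _ (hXm' n))]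
    have hB : ν {θ | θ.1 n ∈ G n}ᶜ = M.P (G n)ᶜ := by
      have hm : MeasurePreserving (fun θ : (ℕ → Ω) × (Fin (j+1) → ℝ) => θ.1 n) ν M.P :=
        (measurePreserving_eval_infinitePi (fun _ : ℕ => M.P) n).comp measurePreserving_fst
      exact hm.measure_preimage (hGm n).compl.nullMeasurableSet
    calc _ ≤ ∫ θ, ({θ : (ℕ → Ω) × (Fin (j+1) → ℝ) | θ.1 n ∈ G n}ᶜ).indicator (fun _ => (1:ℝ)) θ ∂ν := by
          refine norm_integral_le_of_norm_le ((integrable_const _).indicator (hGm' n).compl)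
            (ae_of_all _ fun θ => ?_)
          by_cases h : θ.1 n ∈ G n
          · simp [X, h]
          · have h' : θ ∈ {θ : (ℕ → Ω) × (Fin (j+1) → ℝ) | θ.1 n ∈ G n}ᶜ := h
            rw [Set.indicator_of_mem h', Real.norm_eq_abs, abs_le]
            have a1 := hfn0 n (fun k => Xh n k θ)
            have a2 := hfn1 n (fun k => Xh n k θ)
            have a3 := hfn0 n (fun k => X n k θ)
            have a4 := hfn1 n (fun k => X n k θ)
            constructor <;> linarith
      _ = _ := by
          rw [integral_indicator_const _ (hGm' n).compl, measureReal_def, hB]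
          simp
  have := hdiff.add hDCT
  rw [hlim, zero_add] at this
  simpa using this

end
end
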